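/- arXiv:math/0305336 — 2 statements merged into one kernel-verified Lean document; each statement's English description precedes it below -/
import Mathlib

section
/- Let 𝒜 be a supersolvable central hyperplane arrangement in ℝⁿ and let B be a canonical base region. Then the order dimension of the poset of regions 𝒫(𝒜,B) is equal to the rank of 𝒜. -/
open scoped RealInnerProductSpace

noncomputable section

variable {n : ℕ}

/-- A (linear) hyperplane in ℝⁿ: the zero set of a nonzero linear functional,
expressed via the inner product with a nonzero normal vector. -/
def IsHyperplane (H : Set (EuclideanSpace ℝ (Fin n))) : Prop :=
  ∃ v : EuclideanSpace ℝ (Fin n), v ≠ 0 ∧ H = {x | ⟪v, x⟫ = 0}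

/-- A central hyperplane arrangement: a finite nonempty collection of linear hyperplanes. -/
def IsCentralArrangement (A : Set (Set (EuclideanSpace ℝ (Fin n)))) : Prop :=
  A.Finite ∧ A.Nonempty ∧ ∀ H ∈ A, IsHyperplane H

/-- The complement of the union of the hyperplanes of the arrangement. -/
def arrComplement (A : Set (Set (EuclideanSpace ℝ (Fin n)))) : Set (EuclideanSpace ℝ (Fin n)) :=
  (⋃ H ∈ A, H)ᶜ

/-- A region of the arrangement: the closure of a connected component of the complement
of the union of the hyperplanes. -/
def IsRegion (A : Set (Set (EuclideanSpace ℝ (Fin n)))) (R : Set (EuclideanSpace ℝ (Fin n))) :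
    Prop :=
  ∃ x ∈ arrComplement A, R = closure (connectedComponentIn (arrComplement A) x)

/-- The hyperplane `H` separates the region `R` from the region `B`: their interiors lie on
strictly opposite sides of `H`. -/
def Separates (H R B : Set (EuclideanSpace ℝ (Fin n))) : Prop :=
  ∃ v : EuclideanSpace ℝ (Fin n), v ≠ 0 ∧ H = {x | ⟪v, x⟫ = 0} ∧
    (∀ x ∈ interior R, 0 < ⟪v, x⟫) ∧ (∀ x ∈ interior B, ⟪v, x⟫ < 0)

/-- S(R): the set of hyperplanes of `A` separating `R` from the base region `B`. -/
def sepSet (A : Set (Set (EuclideanSpace ℝ (Fin n)))) (B R : Set (EuclideanSpace ℝ (Fin n))) :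
    Set (Set (EuclideanSpace ℝ (Fin n))) :=
  {H | H ∈ A ∧ Separates H R B}

/-- The order of the poset of regions 𝒫(𝒜,B): containment of separating sets. -/
def regLE (A : Set (Set (EuclideanSpace ℝ (Fin n)))) (B R₁ R₂ : Set (EuclideanSpace ℝ (Fin n))) :
    Prop :=
  sepSet A B R₁ ⊆ sepSet A B R₂

/-- Strict order on regions. -/
def regLT (A : Set (Set (EuclideanSpace ℝ (Fin n)))) (B R₁ R₂ : Set (EuclideanSpace ℝ (Fin n))) :
    Prop :=
  regLE A B R₁ R₂ ∧ ¬ regLE A B R₂ R₁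

/-- The order dimension of the poset of regions 𝒫(𝒜,B): the smallest `d` such that it embeds
as an induced subposet of ℝᵈ with the componentwise order. -/
def regionOrderDim (A : Set (Set (EuclideanSpace ℝ (Fin n))))
    (B : Set (EuclideanSpace ℝ (Fin n))) : ℕ :=
  sInf {d : ℕ | ∃ f : {R : Set (EuclideanSpace ℝ (Fin n)) // IsRegion A R} → (Fin d → ℝ),
    ∀ R₁ R₂, regLE A B R₁.1 R₂.1 ↔ ∀ i, f R₁ i ≤ f R₂ i}

/-- The rank-two subarrangement of `A` consisting of all hyperplanes of `A`
containing `H₁ ∩ H₂`. -/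
def pencil (A : Set (Set (EuclideanSpace ℝ (Fin n)))) (H₁ H₂ : Set (EuclideanSpace ℝ (Fin n))) :
    Set (Set (EuclideanSpace ℝ (Fin n))) :=
  {H | H ∈ A ∧ H₁ ∩ H₂ ⊆ H}

/-- `H` is basic in the subarrangement `A'` relative to the base region `B`:
`H ∈ A'` and `H` bounds (meets in codimension one) the region `B'` of `A'` containing `B`. -/
def IsBasicIn (A' : Set (Set (EuclideanSpace ℝ (Fin n)))) (B H : Set (EuclideanSpace ℝ (Fin n))) :
    Prop :=
  H ∈ A' ∧ ∃ B', IsRegion A' B' ∧ B ⊆ B' ∧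
    Submodule.span ℝ (H ∩ B') = Submodule.span ℝ H

/-- The edge relation of the basic digraph 𝒟(𝒜,B): `H₁ → H₂` whenever `H₁` is basic in the
rank-two subarrangement consisting of all hyperplanes of `A` containing `H₁ ∩ H₂`. -/
def BasicEdge (A : Set (Set (EuclideanSpace ℝ (Fin n))))
    (B H₁ H₂ : Set (EuclideanSpace ℝ (Fin n))) : Prop :=
  H₁ ∈ A ∧ H₂ ∈ A ∧ H₁ ≠ H₂ ∧ IsBasicIn (pencil A H₁ H₂) B H₁

/-- Span(𝒜): the linear span of the normal vectors of the hyperplanes of `A`,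
i.e. the orthogonal complement of the intersection of the hyperplanes. -/
def arrSpan (A : Set (Set (EuclideanSpace ℝ (Fin n)))) :
    Submodule ℝ (EuclideanSpace ℝ (Fin n)) :=
  (Submodule.span ℝ (⋂₀ A))ᗮ

/-- The rank of the arrangement `A`: the dimension of the span of its normal vectors. -/
def arrRank (A : Set (Set (EuclideanSpace ℝ (Fin n)))) : ℕ :=
  Module.finrank ℝ (arrSpan A)

/-- Supersolvability of a central arrangement: every arrangement of rank at most 2 is
supersolvable, and an arrangement of higher rank is supersolvable iff it admits a
partition `A = A₀ ⊎ A₁` with `A₀` supersolvable of rank one less, such that any two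
distinct hyperplanes of `A₁` have their intersection inside a unique hyperplane of `A₀`. -/
inductive IsSupersolvable : Set (Set (EuclideanSpace ℝ (Fin n))) → Prop
  | low : ∀ A : Set (Set (EuclideanSpace ℝ (Fin n))), arrRank A ≤ 2 → IsSupersolvable A
  | step : ∀ A A₀ A₁ : Set (Set (EuclideanSpace ℝ (Fin n))),
      A = A₀ ∪ A₁ → Disjoint A₀ A₁ →
      arrRank A₀ + 1 = arrRank A →
      (∀ H' ∈ A₁, ∀ H'' ∈ A₁, H' ≠ H'' → ∃! H, H ∈ A₀ ∧ H' ∩ H'' ⊆ H) →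
      IsSupersolvable A₀ → IsSupersolvable A

/-- `B` is a canonical base region of the supersolvable arrangement `A`:
any region works in rank at most 2; in higher rank, the region `B₀` of `A₀` containing `B`
is a canonical base region of `A₀` and the regions of `A` contained in `B₀` are linearly
ordered in 𝒫(𝒜,B). -/
inductive IsCanonicalBase :
    Set (Set (EuclideanSpace ℝ (Fin n))) → Set (EuclideanSpace ℝ (Fin n)) → Prop
  | low : ∀ (A : Set (Set (EuclideanSpace ℝ (Fin n)))) (B : Set (EuclideanSpace ℝ (Fin n))),
      arrRank A ≤ 2 → IsRegion A B → IsCanonicalBase A B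
  | step : ∀ (A A₀ A₁ : Set (Set (EuclideanSpace ℝ (Fin n))))
      (B B₀ : Set (EuclideanSpace ℝ (Fin n))),
      A = A₀ ∪ A₁ → Disjoint A₀ A₁ →
      arrRank A₀ + 1 = arrRank A →
      (∀ H' ∈ A₁, ∀ H'' ∈ A₁, H' ≠ H'' → ∃! H, H ∈ A₀ ∧ H' ∩ H'' ⊆ H) →
      IsRegion A B → IsRegion A₀ B₀ → B ⊆ B₀ →
      IsCanonicalBase A₀ B₀ →
      (∀ R R', IsRegion A R → IsRegion A R' → R ⊆ B₀ → R' ⊆ B₀ →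
        regLE A B R R' ∨ regLE A B R' R) →
      IsCanonicalBase A B

section SignPatterns

variable {V ι : Type*} [NormedAddCommGroup V] [InnerProductSpace ℝ V]

/-- The containment order on the sets of vectors `ν H`, `H ∈ A`, that are negative at a point
can be realised by the componentwise order of `ℝᵏ`. -/
def NegSetEmbeds (A : Set ι) (ν : ι → V) (k : ℕ) : Prop :=
  ∃ f : V → Fin k → ℝ, ∀ x y,
    (∀ H ∈ A, ⟪ν H, x⟫ < 0 → ⟪ν H, y⟫ < 0) ↔ ∀ i, f x i ≤ f y i

theorem negSetEmbeds_empty (ν : ι → V) : NegSetEmbeds ∅ ν 0 :=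
  ⟨fun _ i => i.elim0, fun _ _ => ⟨fun _ i => i.elim0, fun _ _ h => h.elim⟩⟩

/-- A weight on finite subsets of a finite set, recording them lexicographically with respect to
an injective real-valued function `t`. -/
theorem exists_lex_weight {A : Set ι} (hA : A.Finite) (t : ι → ℝ) (ht : Set.InjOn t A) :
    ∃ g : Set ι → ℝ, (∀ S T, (∀ H ∈ A, H ∈ S → H ∈ T) → g S ≤ g T) ∧
      ∀ S T, (∃ H ∈ A, H ∈ S ∧ H ∉ T ∧ ∀ K ∈ A, K ∈ T → K ∉ S → t H < t K) → g T < g S := by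
  classical
  lift A to Finset ι using hA
  set e : ι → ℕ := fun H => (A.filter fun K => t H < t K).card with he
  have e_lt : ∀ H K, K ∈ A → t H < t K → e K < e H := by
    intro H K hK h
    refine Finset.card_lt_card ?_
    rw [Finset.ssubset_iff_of_subset]
    · exact ⟨K, by simp [hK, h], by simp⟩
    · intro L hL
      simp only [Finset.mem_filter] at hL ⊢
      exact ⟨hL.1, h.trans hL.2⟩
  have e_inj : Set.InjOn e A := by
    intro H hH K hK h
    by_contra hne
    rcases lt_or_gt_of_ne (fun h' => hne (ht hH hK h')) with h' | h'
    · exact absurd (e_lt H K hK h') (by omega)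
    · exact absurd (e_lt K H hH h') (by omega)
  refine ⟨fun S => ((∑ H ∈ A.filter (· ∈ S), 2 ^ e H : ℕ) : ℝ), ?_, ?_⟩
  · intro S T h
    refine Nat.cast_le.2 (Finset.sum_le_sum_of_subset ?_)
    intro H hH
    simp only [Finset.mem_filter] at hH ⊢
    exact ⟨hH.1, h H hH.1 hH.2⟩
  · rintro S T ⟨H, hH, hHS, hHT, hmin⟩
    refine Nat.cast_lt.2 ?_
    have hT : A.filter (· ∈ T) ⊆
        (A.filter fun K => K ∈ T ∧ K ∈ S) ∪ (A.filter fun K => K ∈ T ∧ K ∉ S) := by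
      intro K hK
      simp only [Finset.mem_filter, Finset.mem_union] at hK ⊢
      tauto
    have hD : ∑ K ∈ A.filter (fun K => K ∈ T ∧ K ∉ S), 2 ^ e K < 2 ^ e H := by
      rw [← Finset.sum_image (f := fun k => 2 ^ k) (g := e)]
      · refine Nat.geomSum_lt le_rfl ?_
        intro k hk
        simp only [Finset.mem_image, Finset.mem_filter] at hk
        obtain ⟨K, ⟨hK, hKT, hKS⟩, rfl⟩ := hk
        exact e_lt H K hK (hmin K hK hKT hKS)
      · intro K hK L hL h
        exact e_inj (Finset.mem_filter.1 hK).1 (Finset.mem_filter.1 hL).1 h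
    have hHn : H ∉ A.filter fun K => K ∈ T ∧ K ∈ S := by simp [hHT]
    calc ∑ K ∈ A.filter (· ∈ T), 2 ^ e K
        ≤ ∑ K ∈ (A.filter fun K => K ∈ T ∧ K ∈ S) ∪ (A.filter fun K => K ∈ T ∧ K ∉ S), 2 ^ e K :=
          Finset.sum_le_sum_of_subset hT
      _ ≤ ∑ K ∈ A.filter (fun K => K ∈ T ∧ K ∈ S), 2 ^ e K
          + ∑ K ∈ A.filter (fun K => K ∈ T ∧ K ∉ S), 2 ^ e K := by
          rw [← Finset.sum_union_inter]; exact Nat.le_add_right _ _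
      _ < ∑ K ∈ A.filter (fun K => K ∈ T ∧ K ∈ S), 2 ^ e K + 2 ^ e H := by omega
      _ = ∑ K ∈ insert H (A.filter fun K => K ∈ T ∧ K ∈ S), 2 ^ e K := by
          rw [Finset.sum_insert hHn, add_comm]
      _ ≤ ∑ K ∈ A.filter (· ∈ S), 2 ^ e K := by
          refine Finset.sum_le_sum_of_subset ?_
          intro K hK
          simp only [Finset.mem_insert, Finset.mem_filter] at hK ⊢
          rcases hK with rfl | hK
          · exact ⟨hH, hHS⟩
          · exact ⟨hK.1, hK.2.2⟩

/-- If all vectors of `A₁` are negative in a direction `w` and any two of them span a vector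
of `A₀` orthogonal to `w`, then adding `A₁` to `A₀` costs one dimension. -/
theorem NegSetEmbeds.union {A₀ A₁ : Set ι} {ν : ι → V} {k : ℕ} (h₀ : NegSetEmbeds A₀ ν k)
    (hfin : A₁.Finite) {b w : V} (hb : ∀ H ∈ A₀, 0 < ⟪ν H, b⟫) (hw : ∀ H ∈ A₁, ⟪ν H, w⟫ < 0)
    (hspan : ∀ H ∈ A₁, ∀ H' ∈ A₁, H ≠ H' →
      ∃ L ∈ A₀, ⟪ν L, w⟫ = 0 ∧ ν L ∈ Submodule.span ℝ {ν H, ν H'}) :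
    NegSetEmbeds (A₀ ∪ A₁) ν (k + 1) := by
  obtain ⟨f, hf⟩ := h₀
  set t : ι → V → ℝ := fun H x => ⟪ν H, x⟫ / (-⟪ν H, w⟫) with ht
  have t_neg : ∀ H ∈ A₁, ∀ x, t H x < 0 ↔ ⟪ν H, x⟫ < 0 := by
    intro H hH x
    have := hw H hH
    simp only [ht]
    rw [div_lt_iff₀ (by linarith), zero_mul]
  have key : ∀ H ∈ A₁, ∀ H' ∈ A₁, H ≠ H' → ∃ L ∈ A₀, ∃ s : ℝ,
      ∀ x, ⟪ν L, x⟫ = s * (t H' x - t H x) := by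
    intro H hH H' hH' hne
    obtain ⟨L, hL, hLw, hLs⟩ := hspan H hH H' hH' hne
    obtain ⟨p, q, hpq⟩ := Submodule.mem_span_pair.1 hLs
    have hα := hw H hH
    have hα' := hw H' hH'
    refine ⟨L, hL, q * (-⟪ν H', w⟫), fun x => ?_⟩
    rw [← hpq, inner_add_left, inner_smul_left, inner_smul_left] at hLw ⊢
    simp only [conj_trivial] at hLw ⊢
    have e : p = - q * ⟪ν H', w⟫ / ⟪ν H, w⟫ := by
      rw [eq_div_iff hα.ne]
      linarith
    have hα0 := hα.ne
    have hα0' := hα'.ne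
    simp only [ht]
    rw [e]
    field_simp
    ring
  have t_inj : Set.InjOn (fun H => t H b) A₁ := by
    intro H hH H' hH' h
    by_contra hne
    obtain ⟨L, hL, s, hs⟩ := key H hH H' hH' hne
    have h1 := hs b
    have h2 := hb L hL
    simp only at h
    rw [h, sub_self, mul_zero] at h1
    linarith
  obtain ⟨g, hg, hg'⟩ := exists_lex_weight hfin (fun H => t H b) t_inj
  refine ⟨fun x => Fin.cons (g {H | ⟪ν H, x⟫ < 0}) (f x), fun x y => ?_⟩
  rw [Fin.forall_fin_succ]
  simp only [Fin.cons_zero, Fin.cons_succ]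
  rw [← hf]
  constructor
  · intro h
    exact ⟨hg _ _ fun H hH => h H (Or.inr hH), fun H hH => h H (Or.inl hH)⟩
  · rintro ⟨h1, h2⟩ H (hH | hH) hx
    · exact h2 H hH hx
    · by_contra hy
      refine absurd h1 (not_le.2 (hg' _ _ ⟨H, hH, hx, hy, ?_⟩))
      intro K hK hKy hKx
      simp only [Set.mem_ofPred_eq] at hKy hKx
      have hne : K ≠ H := by
        rintro rfl
        exact hKx hx
      by_contra hlt
      obtain ⟨L, hL, s, hs⟩ := key K hK H hH hne
      have hb1 := hb L hL
      rw [hs] at hb1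
      have hs0 : 0 < s := by
        by_contra hs0
        nlinarith
      rw [← t_neg _ hH] at hx hy
      rw [← t_neg _ hK] at hKx hKy
      have h3 := h2 L hL
      rw [hs, hs] at h3
      have h4 := h3 (mul_neg_of_pos_of_neg hs0 (by linarith))
      have h5 : 0 < s * (t H y - t K y) := mul_pos hs0 (by linarith)
      linarith

/-- A nonempty open set contains a point off finitely many hyperplanes. -/
theorem exists_mem_open_inner_ne_zero {S : Set V} (hS : S.Finite) (h0 : ∀ s ∈ S, s ≠ 0) :
    ∀ U : Set V, IsOpen U → U.Nonempty → ∃ x ∈ U, ∀ s ∈ S, ⟪s, x⟫ ≠ 0 := by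
  induction S, hS using Set.Finite.induction_on with
  | empty =>
    rintro U - ⟨x, hx⟩
    exact ⟨x, hx, by simp⟩
  | @insert s S _ _ ih =>
    intro U hU ⟨x, hx⟩
    have hs : s ≠ 0 := h0 s (Set.mem_insert _ _)
    obtain ⟨y, ⟨hyU, hys⟩, hy⟩ := ih (fun r hr => h0 r (Set.mem_insert_of_mem _ hr))
      (U ∩ {x | ⟪s, x⟫ ≠ 0})
      (hU.inter (isOpen_ne_fun (by fun_prop) continuous_const)) (by
        by_cases hsx : ⟪s, x⟫ = 0
        · have hc : Filter.Tendsto (fun ε : ℝ => x + ε • s) (nhdsWithin 0 (Set.Ioi 0)) (nhds x) := by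
            have : Continuous fun ε : ℝ => x + ε • s := by fun_prop
            have h := this.tendsto 0
            simp only [zero_smul, add_zero] at h
            exact h.mono_left nhdsWithin_le_nhds
          obtain ⟨ε, hε, hε0⟩ :=
            ((hc.eventually (hU.mem_nhds hx)).and self_mem_nhdsWithin).exists
          refine ⟨_, hε, ?_⟩
          simp only [Set.mem_ofPred_eq, inner_add_right, inner_smul_right, hsx, zero_add]
          exact mul_ne_zero (ne_of_gt hε0) (inner_self_ne_zero.2 hs)
        · exact ⟨x, hx, hsx⟩)
    refine ⟨y, hyU, ?_⟩
    rintro r (rfl | hr)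
    · exact hys
    · exact hy r hr

/-- The members of `A` that bound the cone on which all `ν H` are positive. -/
def walls (A : Set ι) (ν : ι → V) : Set ι :=
  {H ∈ A | ∃ x, ⟪ν H, x⟫ < 0 ∧ ∀ K ∈ A, K ≠ H → 0 < ⟪ν K, x⟫}

theorem exists_wall_inner_neg {A : Set ι} (hA : A.Finite) {ν : ι → V} {b : V}
    (hb : ∀ H ∈ A, 0 < ⟪ν H, b⟫)
    (hpar : ∀ H ∈ A, ∀ K ∈ A, H ≠ K → ν H ∉ Submodule.span ℝ {ν K})
    {w : V} {H₁ : ι} (hH₁ : H₁ ∈ A) (hw : ⟪ν H₁, w⟫ < 0) :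
    ∃ H ∈ walls A ν, ⟪ν H, w⟫ < 0 := by
  set S : Set V := (fun p : ι × ι => ⟪ν p.1, w⟫ • ν p.2 - ⟪ν p.2, w⟫ • ν p.1) ''
    {p ∈ A ×ˢ A | p.1 ≠ p.2 ∧ ⟪ν p.1, w⟫ ≠ 0} with hS
  have hSfin : S.Finite := ((hA.prod hA).subset (Set.sep_subset _ _)).image _
  obtain ⟨c, hc, hcS⟩ := exists_mem_open_inner_ne_zero hSfin (by
    rintro _ ⟨⟨H, K⟩, ⟨⟨hH, hK⟩, hne, h0⟩, rfl⟩ h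
    refine hpar K hK H hH (Ne.symm hne) (Submodule.mem_span_singleton.2
      ⟨⟪ν K, w⟫ / ⟪ν H, w⟫, ?_⟩)
    simp only at h h0
    rw [div_eq_inv_mul, mul_smul, ← sub_eq_zero.1 h, inv_smul_smul₀ h0])
    (⋂ H ∈ A, {x | 0 < ⟪ν H, x⟫})
    (hA.isOpen_biInter fun H _ => isOpen_lt continuous_const (by fun_prop))
    ⟨b, by simpa using hb⟩
  simp only [Set.mem_iInter, Set.mem_ofPred_eq] at hc
  obtain ⟨H, ⟨hH, hHw⟩, hmin⟩ := Set.exists_min_image {H ∈ A | ⟪ν H, w⟫ < 0}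
    (fun H => ⟪ν H, c⟫ / (-⟪ν H, w⟫)) (hA.subset (Set.sep_subset _ _)) ⟨H₁, hH₁, hw⟩
  set r : ℝ := ⟪ν H, c⟫ / (-⟪ν H, w⟫) with hr
  have hr0 : 0 < r := div_pos (hc H hH) (by linarith)
  have hpos : ∀ K ∈ A, K ≠ H → 0 < ⟪ν K, c⟫ + r * ⟪ν K, w⟫ := by
    intro K hK hne
    have h1 := hc K hK
    rcases lt_or_ge ⟪ν K, w⟫ 0 with hKw | hKw
    · have h2 := hmin K ⟨hK, hKw⟩
      rw [le_div_iff₀ (by linarith)] at h2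
      refine lt_of_le_of_ne (by linarith) fun h3 => ?_
      refine hcS _ ⟨(H, K), ⟨⟨hH, hK⟩, Ne.symm hne, ne_of_lt hHw⟩, rfl⟩ ?_
      simp only [inner_sub_left, inner_smul_left, conj_trivial]
      have h4 : ⟪ν H, c⟫ = - r * ⟪ν H, w⟫ := by
        rw [hr, div_neg, neg_neg, div_mul_cancel₀ _ hHw.ne]
      rw [h4]
      linear_combination (-⟪ν H, w⟫) * h3
    · have := mul_nonneg hr0.le hKw
      linarith
  have hev : ∀ᶠ s in nhds r, ∀ K ∈ A, K ≠ H → 0 < ⟪ν K, c⟫ + s * ⟪ν K, w⟫ := by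
    refine (hA.eventually_all).2 fun K hK => ?_
    by_cases hne : K = H
    · simp [hne]
    · have hcont : Continuous fun s : ℝ => ⟪ν K, c⟫ + s * ⟪ν K, w⟫ := by fun_prop
      filter_upwards [hcont.tendsto r (lt_mem_nhds (hpos K hK hne))] with s hs _
      exact hs
  obtain ⟨s, hs, hsr⟩ :=
    ((hev.filter_mono (nhdsWithin_le_nhds (s := Set.Ioi r))).and self_mem_nhdsWithin).exists
  refine ⟨H, ⟨hH, c + s • w, ?_, fun K hK hne => ?_⟩, hHw⟩
  · rw [inner_add_right, inner_smul_right]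
    have h4 : ⟪ν H, c⟫ = - r * ⟪ν H, w⟫ := by
      rw [hr, div_neg, neg_neg, div_mul_cancel₀ _ hHw.ne]
    have h5 : r < s := hsr
    nlinarith
  · rw [inner_add_right, inner_smul_right]
    exact hs K hK hne

theorem span_image_le_span_walls [FiniteDimensional ℝ V] {A : Set ι} (hA : A.Finite) {ν : ι → V}
    {b : V} (hb : ∀ H ∈ A, 0 < ⟪ν H, b⟫)
    (hpar : ∀ H ∈ A, ∀ K ∈ A, H ≠ K → ν H ∉ Submodule.span ℝ {ν K}) :
    Submodule.span ℝ (ν '' A) ≤ Submodule.span ℝ (ν '' walls A ν) := by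
  rw [Submodule.span_le]
  rintro _ ⟨H, hH, rfl⟩
  rw [SetLike.mem_coe, ← Submodule.orthogonal_orthogonal (Submodule.span ℝ (ν '' walls A ν)),
    Submodule.mem_orthogonal]
  intro w hw
  have hw' : ∀ K ∈ walls A ν, ⟪ν K, w⟫ = 0 := fun K hK =>
    (Submodule.mem_orthogonal _ _).1 hw _ (Submodule.subset_span ⟨K, hK, rfl⟩)
  rw [real_inner_comm]
  by_contra hne
  rcases lt_or_gt_of_ne hne with h | h
  · obtain ⟨K, hK, h'⟩ := exists_wall_inner_neg hA hb hpar hH h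
    exact absurd (hw' K hK) h'.ne
  · obtain ⟨K, hK, h'⟩ := exists_wall_inner_neg hA hb hpar (w := -w) hH (by
      rw [inner_neg_right]; linarith)
    rw [inner_neg_right, hw' K hK] at h'
    simp at h'

theorem finrank_span_image_le_ncard_walls [FiniteDimensional ℝ V] {A : Set ι} (hA : A.Finite)
    {ν : ι → V} {b : V} (hb : ∀ H ∈ A, 0 < ⟪ν H, b⟫)
    (hpar : ∀ H ∈ A, ∀ K ∈ A, H ≠ K → ν H ∉ Submodule.span ℝ {ν K}) :
    Module.finrank ℝ (Submodule.span ℝ (ν '' A)) ≤ (walls A ν).ncard := by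
  classical
  have hW : (walls A ν).Finite := hA.subset (Set.sep_subset _ _)
  have hW' := hW.image ν
  refine (Submodule.finrank_mono (span_image_le_span_walls hA hb hpar)).trans ?_
  have := hW'.fintype
  refine (finrank_span_le_card (R := ℝ) (ν '' walls A ν)).trans ?_
  rw [← Set.ncard_eq_toFinset_card']
  exact Set.ncard_image_le hW

/-- Every plane arrangement of vectors positive at a common point embeds in dimension two. -/
theorem negSetEmbeds_two [FiniteDimensional ℝ V] {A : Set ι} (hA : A.Finite) {ν : ι → V}
    {b : V} (hb : ∀ H ∈ A, 0 < ⟪ν H, b⟫)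
    (hpar : ∀ H ∈ A, ∀ K ∈ A, H ≠ K → ν H ∉ Submodule.span ℝ {ν K})
    (hrank : Module.finrank ℝ (Submodule.span ℝ (ν '' A)) = 2) : NegSetEmbeds A ν 2 := by
  obtain ⟨L, hL⟩ : (walls A ν).Nonempty := by
    rw [Set.nonempty_iff_ne_empty]
    intro h
    have := finrank_span_image_le_ncard_walls hA hb hpar
    rw [hrank, h, Set.ncard_empty] at this
    omega
  obtain ⟨hLA, x, hLx, hx⟩ := hL
  have hbL := hb L hLA
  have hL0 : ν L ≠ 0 := by
    intro h
    simp [h] at hbL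
  have hLspan : ν L ∈ Submodule.span ℝ (ν '' A) := Submodule.subset_span ⟨L, hLA, rfl⟩
  obtain ⟨w, hwV, hwL, hw0⟩ : ∃ w ∈ Submodule.span ℝ (ν '' A), ⟪ν L, w⟫ = 0 ∧ w ≠ 0 := by
    obtain ⟨v, hv, hvL⟩ : ∃ v ∈ Submodule.span ℝ (ν '' A), v ∉ Submodule.span ℝ {ν L} := by
      by_contra! h
      have h1 := Submodule.finrank_mono (show Submodule.span ℝ (ν '' A) ≤ _ from h)
      rw [hrank, finrank_span_singleton hL0] at h1
      omega
    refine ⟨v - (⟪ν L, v⟫ / ⟪ν L, ν L⟫) • ν L, Submodule.sub_mem _ hv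
      (Submodule.smul_mem _ _ hLspan), ?_, ?_⟩
    · have : ⟪ν L, ν L⟫ ≠ 0 := inner_self_ne_zero.2 hL0
      rw [inner_sub_right, inner_smul_right]
      field_simp
      ring
    · intro h
      exact hvL (Submodule.mem_span_singleton.2 ⟨_, (sub_eq_zero.1 h).symm⟩)
  have hww : 0 < ⟪w, w⟫ := real_inner_self_pos.2 hw0
  have hLL : 0 < ⟪ν L, ν L⟫ := real_inner_self_pos.2 hL0
  have hplane : Submodule.span ℝ (ν '' A) = Submodule.span ℝ {ν L, w} := by
    symm
    refine Submodule.eq_of_le_of_finrank_eq ?_ ?_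
    · rw [Submodule.span_le]
      rintro _ (rfl | rfl)
      · exact hLspan
      · exact hwV
    · rw [hrank]
      have hli : LinearIndependent ℝ ![ν L, w] := by
        rw [LinearIndependent.pair_iff]
        intro s t hst
        have h1 := congrArg (fun z => ⟪ν L, z⟫) hst
        have h2 := congrArg (fun z => ⟪w, z⟫) hst
        simp only [inner_add_right, inner_smul_right, inner_zero_right, hwL] at h1 h2
        rw [real_inner_comm, hwL] at h2
        constructor
        · simpa [hL0] using h1
        · simpa [hw0] using h2
      have := finrank_span_eq_card hli
      rwa [Matrix.range_cons_cons_empty, Fintype.card_fin] at this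
  have hdec : ∀ H ∈ A, ∃ p q : ℝ, p • ν L + q • w = ν H := fun H hH => by
    have : ν H ∈ Submodule.span ℝ (ν '' A) := Submodule.subset_span ⟨H, hH, rfl⟩
    rw [hplane] at this
    exact Submodule.mem_span_pair.1 this
  have hcoef : ∀ p q : ℝ, ⟪p • ν L + q • w, w⟫ = q * ⟪w, w⟫ := fun p q => by
    rw [inner_add_left, inner_smul_left, inner_smul_left, hwL]
    simp
  have hne : ∀ H ∈ A, H ≠ L → ⟪ν H, w⟫ ≠ 0 := by
    intro H hH hHL h
    obtain ⟨p, q, hpq⟩ := hdec H hH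
    rw [← hpq, hcoef] at h
    have hq : q = 0 := by simpa [hw0] using h
    refine hpar H hH L hLA hHL (Submodule.mem_span_singleton.2 ⟨p, ?_⟩)
    rw [← hpq, hq, zero_smul, add_zero]
  have hsame : ∀ H ∈ A, ∀ K ∈ A, H ≠ L → K ≠ L → 0 < ⟪ν H, w⟫ → ⟪ν K, w⟫ < 0 → False := by
    intro H hH K hK hHL hKL h1 h2
    obtain ⟨p, q, hpq⟩ := hdec H hH
    obtain ⟨p', q', hpq'⟩ := hdec K hK
    have hxH := hx H hH hHL
    have hxK := hx K hK hKL
    have hbH := hb H hH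
    have hbK := hb K hK
    rw [← hpq, hcoef] at h1
    rw [← hpq', hcoef] at h2
    have hq : 0 < q := by
      by_contra hq
      nlinarith
    have hq' : q' < 0 := by
      by_contra hq'
      nlinarith
    rw [← hpq, inner_add_left, inner_smul_left, inner_smul_left] at hxH hbH
    rw [← hpq', inner_add_left, inner_smul_left, inner_smul_left] at hxK hbK
    simp only [conj_trivial] at hxH hxK hbH hbK
    have e1 : 0 < (p * (-q') + p' * q) * ⟪ν L, x⟫ := by
      nlinarith [mul_pos hxH (neg_pos.2 hq'), mul_pos hxK hq]
    have e2 : 0 < (p * (-q') + p' * q) * ⟪ν L, b⟫ := by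
      nlinarith [mul_pos hbH (neg_pos.2 hq'), mul_pos hbK hq]
    have e3 : 0 < p * (-q') + p' * q := by
      by_contra h
      nlinarith
    nlinarith
  have hspan : ∀ u : V, (∀ y, ⟪y, w⟫ = ⟪y, u⟫ ∨ ⟪y, w⟫ = - ⟪y, u⟫) →
      ∀ H ∈ A \ {L}, ∀ H' ∈ A \ {L}, H ≠ H' →
      ∃ L' ∈ ({L} : Set ι), ⟪ν L', u⟫ = 0 ∧ ν L' ∈ Submodule.span ℝ {ν H, ν H'} := by
    intro u hu H hH K hK hHK
    refine ⟨L, rfl, ?_, ?_⟩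
    · rcases hu (ν L) with h | h <;> linarith
    obtain ⟨p, q, hpq⟩ := hdec H hH.1
    obtain ⟨p', q', hpq'⟩ := hdec K hK.1
    have hq' : q' ≠ 0 := by
      rintro rfl
      refine hne K hK.1 hK.2 ?_
      rw [← hpq', hcoef, zero_mul]
    have hd : p * q' - p' * q ≠ 0 := by
      intro hd
      refine hpar H hH.1 K hK.1 hHK (Submodule.mem_span_singleton.2 ⟨q / q', ?_⟩)
      rw [← hpq, ← hpq', smul_add, smul_smul, smul_smul]
      congr 2
      · field_simp; linarith
      · field_simp
    refine Submodule.mem_span_pair.2 ⟨q' / (p * q' - p' * q), - q / (p * q' - p' * q), ?_⟩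
    rw [← hpq, ← hpq']
    have : ν L = ((p * q' - p' * q) / (p * q' - p' * q)) • ν L := by
      rw [div_self hd, one_smul]
    conv_rhs => rw [this]
    module
  have hone : NegSetEmbeds {L} ν 1 := by
    have := (negSetEmbeds_empty ν).union (A₁ := {L}) (Set.finite_singleton L) (b := b) (w := x)
      (by simp) (by rintro _ rfl; exact hLx) (by
        rintro _ rfl _ rfl h
        exact absurd rfl h)
    simpa using this
  have hAL : {L} ∪ A \ {L} = A := by
    rw [Set.union_sdiff_self, Set.union_eq_right]
    rintro _ rfl
    exact hLA
  rw [← hAL]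
  have hbs : ∀ H ∈ ({L} : Set ι), 0 < ⟪ν H, b⟫ := by
    rintro _ rfl
    exact hbL
  by_cases hex : ∃ K ∈ A \ {L}, ⟪ν K, w⟫ < 0
  · obtain ⟨K, hK, hKw⟩ := hex
    refine hone.union hA.sdiff hbs (w := w) (fun H hH => ?_)
      (hspan w fun _ => Or.inl rfl)
    rcases lt_or_gt_of_ne (hne H hH.1 hH.2) with h | h
    · exact h
    · exact (hsame H hH.1 K hK.1 hH.2 hK.2 h hKw).elim
  · push Not at hex
    refine hone.union hA.sdiff hbs (w := -w) (fun H hH => ?_)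
      (hspan (-w) fun y => Or.inr (by rw [inner_neg_right, neg_neg]))
    rw [inner_neg_right]
    have := lt_of_le_of_ne (hex H hH) (hne H hH.1 hH.2).symm
    linarith

theorem negSetEmbeds_of_finrank_le_two [FiniteDimensional ℝ V] {A : Set ι} (hA : A.Finite)
    {ν : ι → V} {b : V} (hb : ∀ H ∈ A, 0 < ⟪ν H, b⟫)
    (hpar : ∀ H ∈ A, ∀ K ∈ A, H ≠ K → ν H ∉ Submodule.span ℝ {ν K})
    (hrank : Module.finrank ℝ (Submodule.span ℝ (ν '' A)) ≤ 2) :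
    NegSetEmbeds A ν (Module.finrank ℝ (Submodule.span ℝ (ν '' A))) := by
  rcases A.eq_empty_or_nonempty with rfl | ⟨L, hL⟩
  · rw [Set.image_empty, Submodule.span_empty, finrank_bot]
    exact negSetEmbeds_empty ν
  have hbL := hb L hL
  have hL0 : ν L ≠ 0 := by
    intro h
    simp [h] at hbL
  have hle : Submodule.span ℝ {ν L} ≤ Submodule.span ℝ (ν '' A) :=
    Submodule.span_mono (by rintro _ rfl; exact ⟨L, hL, rfl⟩)
  have h1 := Submodule.finrank_mono hle
  rw [finrank_span_singleton hL0] at h1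
  rcases h1.eq_or_lt with h1 | h1
  · have hsp : Submodule.span ℝ {ν L} = Submodule.span ℝ (ν '' A) :=
      Submodule.eq_of_le_of_finrank_eq hle (by rw [finrank_span_singleton hL0, h1])
    have hsub : A = {L} := by
      refine Set.eq_singleton_iff_unique_mem.2 ⟨hL, fun H hH => ?_⟩
      by_contra hne
      refine hpar H hH L hL hne ?_
      rw [hsp]
      exact Submodule.subset_span ⟨H, hH, rfl⟩
    rw [← h1]
    have := (negSetEmbeds_empty ν).union (A₁ := A) hA (b := b) (w := -b)
      (by simp) (fun H hH => by
        rw [inner_neg_right]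
        linarith [hb H hH]) (by
        rw [hsub]
        rintro _ rfl _ rfl h
        exact absurd rfl h)
    simpa using this
  · have h2 : Module.finrank ℝ (Submodule.span ℝ (ν '' A)) = 2 := by omega
    rw [h2]
    exact negSetEmbeds_two hA hb hpar h2

end SignPatterns
section Hyperplanes

theorem inner_zero_set_eq_of_mem_span_singleton {v w : EuclideanSpace ℝ (Fin n)} (hv : v ≠ 0)
    (h : v ∈ Submodule.span ℝ {w}) : {x | ⟪v, x⟫ = 0} = {x | ⟪w, x⟫ = 0} := by
  obtain ⟨c, rfl⟩ := Submodule.mem_span_singleton.1 h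
  have hc : c ≠ 0 := by
    rintro rfl
    simp at hv
  ext x
  simp [inner_smul_left, hc]

theorem exists_smul_eq_of_inner_zero_set_eq {v w : EuclideanSpace ℝ (Fin n)}
    (h : {x | ⟪v, x⟫ = 0} = {x | ⟪w, x⟫ = 0}) : ∃ c : ℝ, c • v = w := by
  refine Submodule.mem_span_singleton.1 ?_
  rw [← Submodule.orthogonal_orthogonal (Submodule.span ℝ {v}), Submodule.mem_orthogonal]
  intro x hx
  have h1 : ⟪v, x⟫ = 0 := Submodule.mem_orthogonal_singleton_iff_inner_right.1 hx
  have h2 : x ∈ {x | ⟪w, x⟫ = 0} := by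
    rw [← h]
    exact h1
  rw [real_inner_comm]
  exact h2

/-- `ν` selects for every member of `A` a normal vector that is positive at `b`. -/
def IsNormalChoice (A : Set (Set (EuclideanSpace ℝ (Fin n)))) (b : EuclideanSpace ℝ (Fin n))
    (ν : Set (EuclideanSpace ℝ (Fin n)) → EuclideanSpace ℝ (Fin n)) : Prop :=
  ∀ H ∈ A, H = {x | ⟪ν H, x⟫ = 0} ∧ 0 < ⟪ν H, b⟫

variable {A : Set (Set (EuclideanSpace ℝ (Fin n)))} {b : EuclideanSpace ℝ (Fin n)}
  {ν : Set (EuclideanSpace ℝ (Fin n)) → EuclideanSpace ℝ (Fin n)}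

theorem exists_isNormalChoice (hA : ∀ H ∈ A, IsHyperplane H) (hb : b ∈ arrComplement A) :
    ∃ ν, IsNormalChoice A b ν := by
  have h : ∀ H : Set (EuclideanSpace ℝ (Fin n)), ∃ v : EuclideanSpace ℝ (Fin n),
      H ∈ A → H = {x | ⟪v, x⟫ = 0} ∧ 0 < ⟪v, b⟫ := by
    intro H
    by_cases hH : H ∈ A
    · obtain ⟨v, -, hHv⟩ := hA H hH
      have hbH : b ∉ H := fun hbH => hb (Set.mem_biUnion hH hbH)
      have hvb : ⟪v, b⟫ ≠ 0 := fun h0 => hbH (by rw [hHv]; exact h0)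
      rcases lt_or_gt_of_ne hvb with h | h
      · refine ⟨-v, fun _ => ⟨?_, ?_⟩⟩
        · simpa using hHv
        · rw [inner_neg_left]
          linarith
      · exact ⟨v, fun _ => ⟨hHv, h⟩⟩
    · exact ⟨0, fun h => (hH h).elim⟩
  choose ν hν using h
  exact ⟨ν, fun H hH => hν H hH⟩

namespace IsNormalChoice

theorem mono {A' : Set (Set (EuclideanSpace ℝ (Fin n)))} (hν : IsNormalChoice A b ν)
    (h : A' ⊆ A) : IsNormalChoice A' b ν :=
  fun H hH => hν H (h hH)

theorem ne_zero (hν : IsNormalChoice A b ν) {H : Set (EuclideanSpace ℝ (Fin n))} (hH : H ∈ A) :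
    ν H ≠ 0 := by
  intro h
  have := (hν H hH).2
  simp [h] at this

theorem mem_iff (hν : IsNormalChoice A b ν) {H : Set (EuclideanSpace ℝ (Fin n))} (hH : H ∈ A)
    {x : EuclideanSpace ℝ (Fin n)} : x ∈ H ↔ ⟪ν H, x⟫ = 0 := by
  conv_lhs => rw [(hν H hH).1]
  rfl

theorem notMem_span (hν : IsNormalChoice A b ν) :
    ∀ H ∈ A, ∀ K ∈ A, H ≠ K → ν H ∉ Submodule.span ℝ {ν K} := by
  intro H hH K hK hne h
  refine hne ?_
  rw [(hν H hH).1, (hν K hK).1]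
  exact inner_zero_set_eq_of_mem_span_singleton (hν.ne_zero hH) h

theorem mem_span_pair (hν : IsNormalChoice A b ν) {H K L : Set (EuclideanSpace ℝ (Fin n))}
    (hH : H ∈ A) (hK : K ∈ A) (hL : L ∈ A) (h : H ∩ K ⊆ L) :
    ν L ∈ Submodule.span ℝ {ν H, ν K} := by
  rw [← Submodule.orthogonal_orthogonal (Submodule.span ℝ {ν H, ν K}), Submodule.mem_orthogonal]
  intro x hx
  rw [Submodule.mem_orthogonal] at hx
  rw [real_inner_comm, ← hν.mem_iff hL]
  exact h ⟨(hν.mem_iff hH).2 (hx _ (Submodule.subset_span (by simp))),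
    (hν.mem_iff hK).2 (hx _ (Submodule.subset_span (by simp)))⟩

theorem arrSpan_eq (hν : IsNormalChoice A b ν) : arrSpan A = Submodule.span ℝ (ν '' A) := by
  have h : ⋂₀ A = ((Submodule.span ℝ (ν '' A))ᗮ : Submodule ℝ (EuclideanSpace ℝ (Fin n))) := by
    ext x
    rw [Set.mem_sInter, SetLike.mem_coe, Submodule.mem_orthogonal]
    constructor
    · intro hx u hu
      induction hu using Submodule.span_induction with
      | mem u hu =>
        obtain ⟨H, hH, rfl⟩ := hu
        exact (hν.mem_iff hH).1 (hx H hH)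
      | zero => simp
      | add u v _ _ hu hv => rw [inner_add_left, hu, hv, add_zero]
      | smul c u _ hu => rw [inner_smul_left, hu, mul_zero]
    · intro hx H hH
      exact (hν.mem_iff hH).2 (hx _ (Submodule.subset_span ⟨H, hH, rfl⟩))
  rw [arrSpan, h, Submodule.span_eq, Submodule.orthogonal_orthogonal]

theorem arrRank_eq (hν : IsNormalChoice A b ν) :
    arrRank A = Module.finrank ℝ (Submodule.span ℝ (ν '' A)) := by
  rw [arrRank, hν.arrSpan_eq]

theorem mem_arrComplement (hν : IsNormalChoice A b ν) {x : EuclideanSpace ℝ (Fin n)} :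
    x ∈ arrComplement A ↔ ∀ H ∈ A, ⟪ν H, x⟫ ≠ 0 := by
  simp only [arrComplement, Set.mem_compl_iff, Set.mem_iUnion, not_exists]
  exact forall₂_congr fun H hH => not_congr (hν.mem_iff hH)

theorem isOpen_arrComplement (hν : IsNormalChoice A b ν) (hA : A.Finite) :
    IsOpen (arrComplement A) := by
  refine (hA.isClosed_biUnion fun H hH => ?_).isOpen_compl
  rw [(hν H hH).1]
  exact isClosed_eq (by fun_prop) continuous_const

/-- The normal of a hyperplane of `A` has constant sign on the region around `x`. -/
theorem inner_neg_of_mem_component (hν : IsNormalChoice A b ν)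
    {H : Set (EuclideanSpace ℝ (Fin n))} (hH : H ∈ A) {x y : EuclideanSpace ℝ (Fin n)}
    (hx : ⟪ν H, x⟫ < 0) (hxA : x ∈ arrComplement A)
    (hy : y ∈ connectedComponentIn (arrComplement A) x) : ⟪ν H, y⟫ < 0 := by
  by_contra! hle
  obtain ⟨z, hz, hz0⟩ := isPreconnected_connectedComponentIn.intermediate_value
    (mem_connectedComponentIn hxA) hy (f := fun z => ⟪ν H, z⟫) (by fun_prop) ⟨hx.le, hle⟩
  exact hν.mem_arrComplement.1 (connectedComponentIn_subset _ _ hz) H hH hz0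

theorem inner_pos_of_mem_component (hν : IsNormalChoice A b ν)
    {H : Set (EuclideanSpace ℝ (Fin n))} (hH : H ∈ A) {x y : EuclideanSpace ℝ (Fin n)}
    (hx : 0 < ⟪ν H, x⟫) (hxA : x ∈ arrComplement A)
    (hy : y ∈ connectedComponentIn (arrComplement A) x) : 0 < ⟪ν H, y⟫ := by
  by_contra! hle
  obtain ⟨z, hz, hz0⟩ := isPreconnected_connectedComponentIn.intermediate_value
    hy (mem_connectedComponentIn hxA) (f := fun z => ⟪ν H, z⟫) (by fun_prop) ⟨hle, hx.le⟩
  exact hν.mem_arrComplement.1 (connectedComponentIn_subset _ _ hz) H hH hz0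

end IsNormalChoice

theorem inner_pos_of_mem_interior_closure {C : Set (EuclideanSpace ℝ (Fin n))}
    {v : EuclideanSpace ℝ (Fin n)} (hv : v ≠ 0) (hC : ∀ x ∈ C, 0 < ⟪v, x⟫)
    {x : EuclideanSpace ℝ (Fin n)} (hx : x ∈ interior (closure C)) : 0 < ⟪v, x⟫ := by
  have hcl : closure C ⊆ {x | 0 ≤ ⟪v, x⟫} :=
    closure_minimal (fun x hx => (hC x hx).le) (isClosed_le continuous_const (by fun_prop))
  have hcont : Continuous fun ε : ℝ => x - ε • v := by fun_prop
  have hlim := hcont.tendsto 0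
  simp only [zero_smul, sub_zero] at hlim
  obtain ⟨ε, hε, hε0⟩ := (((hlim.mono_left (nhdsWithin_le_nhds (s := Set.Ioi 0))).eventually
    (isOpen_interior.mem_nhds hx)).and self_mem_nhdsWithin).exists
  have h1 : 0 ≤ ⟪v, x - ε • v⟫ := hcl (interior_subset hε)
  rw [inner_sub_right, inner_smul_right] at h1
  have h2 : 0 < ε * ⟪v, v⟫ := mul_pos hε0 (real_inner_self_pos.2 hv)
  linarith

namespace IsNormalChoice

theorem mem_interior_region (hν : IsNormalChoice A b ν) (hA : A.Finite)
    {x : EuclideanSpace ℝ (Fin n)} (hx : x ∈ arrComplement A) :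
    x ∈ interior (closure (connectedComponentIn (arrComplement A) x)) :=
  interior_maximal subset_closure (hν.isOpen_arrComplement hA).connectedComponentIn
    (mem_connectedComponentIn hx)

theorem base_mem_arrComplement (hν : IsNormalChoice A b ν) : b ∈ arrComplement A :=
  hν.mem_arrComplement.2 fun H hH => (hν H hH).2.ne'

/-- The hyperplanes separating the regions of two points, in terms of signs. -/
theorem mem_sepSet_iff (hν : IsNormalChoice A b ν) (hA : A.Finite)
    {x : EuclideanSpace ℝ (Fin n)} (hx : x ∈ arrComplement A)
    {H : Set (EuclideanSpace ℝ (Fin n))} :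
    H ∈ sepSet A (closure (connectedComponentIn (arrComplement A) b))
      (closure (connectedComponentIn (arrComplement A) x)) ↔ H ∈ A ∧ ⟪ν H, x⟫ < 0 := by
  refine and_congr_right fun hH => ?_
  constructor
  · rintro ⟨v, -, hHv, hpos, hneg⟩
    have h1 := hpos x (hν.mem_interior_region hA hx)
    have h2 := hneg b (hν.mem_interior_region hA hν.base_mem_arrComplement)
    obtain ⟨c, rfl⟩ := exists_smul_eq_of_inner_zero_set_eq ((hν H hH).1.symm.trans hHv)
    have h3 := (hν H hH).2
    rw [inner_smul_left, conj_trivial] at h1 h2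
    have hc : c < 0 := by
      by_contra hc
      nlinarith
    by_contra h4
    nlinarith
  · intro hneg
    refine ⟨-ν H, neg_ne_zero.2 (hν.ne_zero hH), ?_, ?_, ?_⟩
    · simpa using (hν H hH).1
    · intro y hy
      refine inner_pos_of_mem_interior_closure (neg_ne_zero.2 (hν.ne_zero hH)) (fun z hz => ?_) hy
      rw [inner_neg_left]
      linarith [hν.inner_neg_of_mem_component hH hneg hx hz]
    · intro y hy
      have := inner_pos_of_mem_interior_closure (hν.ne_zero hH)
        (fun z hz => hν.inner_pos_of_mem_component hH (hν H hH).2 hν.base_mem_arrComplement hz) hy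
      rw [inner_neg_left]
      linarith

theorem regLE_iff (hν : IsNormalChoice A b ν) (hA : A.Finite) {x y : EuclideanSpace ℝ (Fin n)}
    (hx : x ∈ arrComplement A) (hy : y ∈ arrComplement A) :
    regLE A (closure (connectedComponentIn (arrComplement A) b))
      (closure (connectedComponentIn (arrComplement A) x))
      (closure (connectedComponentIn (arrComplement A) y)) ↔
      ∀ H ∈ A, ⟪ν H, x⟫ < 0 → ⟪ν H, y⟫ < 0 := by
  constructor
  · intro h H hH hHx
    exact ((hν.mem_sepSet_iff hA hy).1 (h ((hν.mem_sepSet_iff hA hx).2 ⟨hH, hHx⟩))).2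
  · intro h H hH
    rw [hν.mem_sepSet_iff hA hx] at hH
    exact (hν.mem_sepSet_iff hA hy).2 ⟨hH.1, h H hH.1 hH.2⟩

/-- Points on which all normals have the same strict signs lie in the same component. -/
theorem mem_component_of_sign_eq (hν : IsNormalChoice A b ν) {x y : EuclideanSpace ℝ (Fin n)}
    (h : ∀ H ∈ A, 0 < ⟪ν H, x⟫ * ⟪ν H, y⟫) :
    y ∈ connectedComponentIn (arrComplement A) x := by
  refine (convex_segment x y).isPreconnected.subset_connectedComponentIn
    (left_mem_segment ℝ x y) ?_ (right_mem_segment ℝ x y)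
  rintro _ ⟨s, t, hs, ht, hst, rfl⟩
  refine hν.mem_arrComplement.2 fun H hH h0 => ?_
  rw [inner_add_right, inner_smul_right, inner_smul_right] at h0
  have h1 := h H hH
  rcases mul_pos_iff.1 h1 with ⟨hx, hy⟩ | ⟨hx, hy⟩
  · rcases hs.eq_or_lt with rfl | hs
    · nlinarith
    · nlinarith [mul_pos hs hx, mul_nonneg ht hy.le]
  · rcases hs.eq_or_lt with rfl | hs
    · nlinarith
    · nlinarith [mul_pos hs (neg_pos.2 hx), mul_nonneg ht (neg_pos.2 hy).le]

theorem sign_eq_of_mem_closure_component (hν : IsNormalChoice A b ν)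
    {x : EuclideanSpace ℝ (Fin n)} (hx : x ∈ arrComplement A)
    (hb : b ∈ closure (connectedComponentIn (arrComplement A) x)) :
    ∀ H ∈ A, 0 < ⟪ν H, x⟫ := by
  intro H hH
  by_contra hle
  have hneg : ⟪ν H, x⟫ < 0 :=
    lt_of_le_of_ne (not_lt.1 hle) (hν.mem_arrComplement.1 hx H hH)
  have hcl : closure (connectedComponentIn (arrComplement A) x) ⊆ {y | ⟪ν H, y⟫ ≤ 0} :=
    closure_minimal (fun y hy => (hν.inner_neg_of_mem_component hH hneg hx hy).le)
      (isClosed_le (by fun_prop) continuous_const)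
  have h1 : ⟪ν H, b⟫ ≤ 0 := hcl hb
  exact absurd (hν H hH).2 (not_lt.2 h1)

/-- The region containing the base point is the region around the base point. -/
theorem region_eq_of_mem (hν : IsNormalChoice A b ν) {B : Set (EuclideanSpace ℝ (Fin n))}
    (hB : IsRegion A B) (hb : b ∈ B) :
    B = closure (connectedComponentIn (arrComplement A) b) := by
  obtain ⟨x, hx, rfl⟩ := hB
  rw [connectedComponentIn_eq (hν.mem_component_of_sign_eq fun H hH =>
    mul_pos (hν.sign_eq_of_mem_closure_component hx hb H hH) (hν H hH).2)]

/-- A direction along the fibres of `A₀` that is transversal to all remaining hyperplanes. -/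
theorem exists_fiber_direction {A₀ A₁ : Set (Set (EuclideanSpace ℝ (Fin n)))}
    (hν : IsNormalChoice (A₀ ∪ A₁) b ν) (hdisj : Disjoint A₀ A₁)
    (hrank : arrRank A₀ + 1 = arrRank (A₀ ∪ A₁))
    (hmod : ∀ H' ∈ A₁, ∀ H'' ∈ A₁, H' ≠ H'' → ∃! H, H ∈ A₀ ∧ H' ∩ H'' ⊆ H) :
    ∃ w, (∀ H ∈ A₀, ⟪ν H, w⟫ = 0) ∧ ∀ H ∈ A₁, ⟪ν H, w⟫ ≠ 0 := by
  obtain ⟨w, hw₀, K, hK, hKw⟩ : ∃ w, (∀ H ∈ A₀, ⟪ν H, w⟫ = 0) ∧ ∃ K ∈ A₀ ∪ A₁, ⟪ν K, w⟫ ≠ 0 := by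
    by_contra! h
    have hle : Submodule.span ℝ (ν '' (A₀ ∪ A₁)) ≤ Submodule.span ℝ (ν '' A₀) := by
      rw [Submodule.span_le]
      rintro _ ⟨K, hK, rfl⟩
      rw [SetLike.mem_coe, ← Submodule.orthogonal_orthogonal (Submodule.span ℝ (ν '' A₀)),
        Submodule.mem_orthogonal]
      intro w hw
      rw [real_inner_comm]
      exact h w (fun H hH => (Submodule.mem_orthogonal _ _).1 hw _
        (Submodule.subset_span ⟨H, hH, rfl⟩)) K hK
    have := Submodule.finrank_mono hle
    rw [← hν.arrRank_eq, ← (hν.mono Set.subset_union_left).arrRank_eq] at this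
    omega
  have hK₁ : K ∈ A₁ := hK.resolve_left fun hK₀ => hKw (hw₀ K hK₀)
  refine ⟨w, hw₀, fun H hH hHw => ?_⟩
  have hne : H ≠ K := by
    rintro rfl
    exact hKw hHw
  obtain ⟨L, ⟨hL, hHKL⟩, -⟩ := hmod H hH K hK₁ hne
  obtain ⟨p, q, hpq⟩ := Submodule.mem_span_pair.1
    (hν.mem_span_pair (Or.inr hH) hK (Or.inl hL) hHKL)
  have h0 := hw₀ L hL
  rw [← hpq, inner_add_left, inner_smul_left, inner_smul_left, hHw, mul_zero, zero_add] at h0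
  have hq : q = 0 := by simpa [hKw] using h0
  refine hν.notMem_span L (Or.inl hL) H (Or.inr hH) ?_
    (Submodule.mem_span_singleton.2 ⟨p, by rw [← hpq, hq, zero_smul, add_zero]⟩)
  rintro rfl
  exact Set.disjoint_left.1 hdisj hL hH

/-- If the regions in one region of `A₀` are linearly ordered, then all remaining hyperplanes lie
on the same side of the base region along the fibre direction `w`. -/
theorem fiber_direction_sign {A₀ A₁ : Set (Set (EuclideanSpace ℝ (Fin n)))}
    (hν : IsNormalChoice (A₀ ∪ A₁) b ν) (hfin : (A₀ ∪ A₁).Finite)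
    {w : EuclideanSpace ℝ (Fin n)} (hw₀ : ∀ H ∈ A₀, ⟪ν H, w⟫ = 0) (hw₁ : ∀ H ∈ A₁, ⟪ν H, w⟫ ≠ 0)
    (hlin : ∀ R R', IsRegion (A₀ ∪ A₁) R → IsRegion (A₀ ∪ A₁) R' →
      R ⊆ closure (connectedComponentIn (arrComplement A₀) b) →
      R' ⊆ closure (connectedComponentIn (arrComplement A₀) b) →
      regLE (A₀ ∪ A₁) (closure (connectedComponentIn (arrComplement (A₀ ∪ A₁)) b)) R R' ∨
      regLE (A₀ ∪ A₁) (closure (connectedComponentIn (arrComplement (A₀ ∪ A₁)) b)) R' R)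
    {H K : Set (EuclideanSpace ℝ (Fin n))} (hH : H ∈ A₁) (hK : K ∈ A₁)
    (hHw : ⟪ν H, w⟫ < 0) : ⟪ν K, w⟫ < 0 := by
  by_contra hKw
  have hKw : 0 < ⟪ν K, w⟫ := lt_of_le_of_ne (not_lt.1 hKw) (hw₁ K hK).symm
  obtain ⟨t, ht⟩ : ∃ t : ℝ, ∀ L ∈ A₁, ⟪ν L, b⟫ < t * |⟪ν L, w⟫| := by
    have hev : ∀ᶠ t : ℝ in Filter.atTop, ∀ L ∈ A₁, ⟪ν L, b⟫ < t * |⟪ν L, w⟫| := by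
      refine ((hfin.subset Set.subset_union_right).eventually_all).2 fun L hL => ?_
      filter_upwards [Filter.eventually_gt_atTop (⟪ν L, b⟫ / |⟪ν L, w⟫|)] with t ht
      rwa [div_lt_iff₀ (abs_pos.2 (hw₁ L hL))] at ht
    exact hev.exists
  have hcompl : ∀ s : ℝ, |s| = t → b + s • w ∈ arrComplement (A₀ ∪ A₁) ∧
      closure (connectedComponentIn (arrComplement (A₀ ∪ A₁)) (b + s • w)) ⊆
        closure (connectedComponentIn (arrComplement A₀) b) := by
    intro s hs
    have hsub : arrComplement (A₀ ∪ A₁) ⊆ arrComplement A₀ :=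
      Set.compl_subset_compl.2 (Set.biUnion_subset_biUnion_left Set.subset_union_left)
    refine ⟨hν.mem_arrComplement.2 ?_, closure_mono ?_⟩
    · rintro L (hL | hL) h0 <;> rw [inner_add_right, inner_smul_right] at h0
      · rw [hw₀ L hL, mul_zero, add_zero] at h0
        exact absurd h0 (hν L (Or.inl hL)).2.ne'
      · have h1 := ht L hL
        rw [← hs, ← abs_mul, show s * ⟪ν L, w⟫ = - ⟪ν L, b⟫ by linarith, abs_neg,
          abs_of_pos (hν L (Or.inr hL)).2] at h1
        exact lt_irrefl _ h1
    · rw [connectedComponentIn_eq ((hν.mono Set.subset_union_left).mem_component_of_sign_eq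
        (x := b) (y := b + s • w) fun L hL => ?_)]
      · exact connectedComponentIn_mono _ hsub
      · rw [inner_add_right, inner_smul_right, hw₀ L hL, mul_zero, add_zero]
        exact mul_pos (hν L (Or.inl hL)).2 (hν L (Or.inl hL)).2
  have htH := ht H hH
  have htK := ht K hK
  have hbH := (hν H (Or.inr hH)).2
  have hbK := (hν K (Or.inr hK)).2
  rw [abs_of_neg hHw] at htH
  rw [abs_of_pos hKw] at htK
  have ht0 : 0 < t := by
    by_contra h
    nlinarith
  obtain ⟨hx, hx'⟩ := hcompl t (abs_of_pos ht0)
  obtain ⟨hy, hy'⟩ := hcompl (-t) (by rw [abs_neg, abs_of_pos ht0])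
  rcases hlin _ _ ⟨_, hx, rfl⟩ ⟨_, hy, rfl⟩ hx' hy' with h | h
  · rw [hν.regLE_iff hfin hx hy] at h
    have := h H (Or.inr hH) (by rw [inner_add_right, inner_smul_right]; linarith)
    rw [inner_add_right, inner_smul_right] at this
    nlinarith
  · rw [hν.regLE_iff hfin hy hx] at h
    have := h K (Or.inr hK) (by rw [inner_add_right, inner_smul_right]; linarith)
    rw [inner_add_right, inner_smul_right] at this
    nlinarith

end IsNormalChoice

theorem IsCanonicalBase.negSetEmbeds {A : Set (Set (EuclideanSpace ℝ (Fin n)))}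
    {B : Set (EuclideanSpace ℝ (Fin n))} (hB : IsCanonicalBase A B) (hfin : A.Finite)
    {b : EuclideanSpace ℝ (Fin n)} (hbB : b ∈ B)
    {ν : Set (EuclideanSpace ℝ (Fin n)) → EuclideanSpace ℝ (Fin n)}
    (hν : IsNormalChoice A b ν) : NegSetEmbeds A ν (arrRank A) := by
  induction hB with
  | low A B hrank _ =>
    rw [hν.arrRank_eq] at hrank ⊢
    exact negSetEmbeds_of_finrank_le_two hfin (fun H hH => (hν H hH).2) hν.notMem_span hrank
  | step A A₀ A₁ B B₀ hA hdisj hrank hmod hB hB₀ hBB₀ _ hlin ih =>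
    subst hA
    have hν₀ := hν.mono (Set.subset_union_left (s := A₀) (t := A₁))
    have h₀ := ih (hfin.subset Set.subset_union_left) (hBB₀ hbB) hν₀
    rw [hν₀.region_eq_of_mem hB₀ (hBB₀ hbB), hν.region_eq_of_mem hB hbB] at hlin
    obtain ⟨w, hw₀, hw₁⟩ := hν.exists_fiber_direction hdisj hrank hmod
    have hspan : ∀ u : EuclideanSpace ℝ (Fin n), (∀ H ∈ A₀, ⟪ν H, u⟫ = 0) →
        ∀ H ∈ A₁, ∀ H' ∈ A₁, H ≠ H' →
        ∃ L ∈ A₀, ⟪ν L, u⟫ = 0 ∧ ν L ∈ Submodule.span ℝ {ν H, ν H'} := by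
      intro u hu H hH H' hH' hne
      obtain ⟨L, ⟨hL, hsub⟩, -⟩ := hmod H hH H' hH' hne
      exact ⟨L, hL, hu L hL, hν.mem_span_pair (Or.inr hH) (Or.inr hH') (Or.inl hL) hsub⟩
    rw [← hrank]
    by_cases hex : ∃ H ∈ A₁, ⟪ν H, w⟫ < 0
    · obtain ⟨H, hH, hHw⟩ := hex
      exact h₀.union (hfin.subset Set.subset_union_right) (fun H hH => (hν₀ H hH).2)
        (fun K hK => hν.fiber_direction_sign hfin hw₀ hw₁ hlin hH hK hHw) (hspan w hw₀)
    · push Not at hex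
      refine h₀.union (hfin.subset Set.subset_union_right) (fun H hH => (hν₀ H hH).2)
        (w := -w) (fun K hK => ?_) (hspan (-w) fun H hH => by
          rw [inner_neg_right, hw₀ H hH, neg_zero])
      rw [inner_neg_right]
      have := lt_of_le_of_ne (hex K hK) (hw₁ K hK).symm
      linarith

/-- The regions adjacent to the base region and their opposites form a standard example, which
bounds the dimension of any embedding from below. -/
theorem IsNormalChoice.ncard_walls_le {A : Set (Set (EuclideanSpace ℝ (Fin n)))}
    {b : EuclideanSpace ℝ (Fin n)}
    {ν : Set (EuclideanSpace ℝ (Fin n)) → EuclideanSpace ℝ (Fin n)}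
    (hν : IsNormalChoice A b ν) (hfin : A.Finite) {d : ℕ}
    (f : {R : Set (EuclideanSpace ℝ (Fin n)) // IsRegion A R} → (Fin d → ℝ))
    (hf : ∀ R₁ R₂, regLE A (closure (connectedComponentIn (arrComplement A) b)) R₁.1 R₂.1 ↔
      ∀ i, f R₁ i ≤ f R₂ i) : (walls A ν).ncard ≤ d := by
  have hwall : ∀ H : walls A ν, ∃ x, ⟪ν H, x⟫ < 0 ∧ ∀ K ∈ A, K ≠ H → 0 < ⟪ν K, x⟫ :=
    fun H => H.2.2
  choose x hx hx' using hwall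
  have hxA : ∀ H, x H ∈ arrComplement A := by
    intro H
    refine hν.mem_arrComplement.2 fun K hK => ?_
    by_cases h : K = H
    · rw [h]
      exact (hx H).ne
    · exact (hx' H K hK h).ne'
  have hxA' : ∀ H, -x H ∈ arrComplement A := by
    intro H
    refine hν.mem_arrComplement.2 fun K hK => ?_
    rw [inner_neg_right, neg_ne_zero]
    exact hν.mem_arrComplement.1 (hxA H) K hK
  set atom : walls A ν → {R : Set (EuclideanSpace ℝ (Fin n)) // IsRegion A R} :=
    fun H => ⟨_, x H, hxA H, rfl⟩
  set coatom : walls A ν → {R : Set (EuclideanSpace ℝ (Fin n)) // IsRegion A R} :=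
    fun H => ⟨_, -x H, hxA' H, rfl⟩
  have hle : ∀ H K, H ≠ K → ∀ i, f (atom H) i ≤ f (coatom K) i := by
    intro H K hne
    refine (hf _ _).1 ((hν.regLE_iff hfin (hxA H) (hxA' K)).2 fun L hL hLx => ?_)
    have hLH : L = H := by
      by_contra h
      exact absurd (hx' H L hL h) (not_lt.2 hLx.le)
    rw [inner_neg_right]
    have := hx' K L hL (by rw [hLH]; exact fun h => hne (Subtype.ext h))
    linarith
  have hnle : ∀ H, ∃ i, f (coatom H) i < f (atom H) i := by
    intro H
    by_contra! h
    have h1 := (hν.regLE_iff hfin (hxA H) (hxA' H)).1 ((hf (atom H) (coatom H)).2 h) H H.2.1 (hx H)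
    rw [inner_neg_right] at h1
    linarith [hx H]
  choose i hi using hnle
  have hinj : Function.Injective i := by
    intro H K h
    by_contra hne
    have h1 := hi H
    have h2 := hi K
    rw [← h] at h2
    linarith [hle H K hne (i H), hle K H (Ne.symm hne) (i H)]
  have := Nat.card_le_card_of_injective i hinj
  rwa [Nat.card_coe_set_eq, Nat.card_fin] at this

end Hyperplanes

/-- **Theorem (Reading, Theorem 22).** The order dimension of the poset of regions of a
supersolvable central hyperplane arrangement, with respect to a canonical base region,
equals the rank of the arrangement. -/
theorem orderDim_supersolvable_eq_rank {n : ℕ}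
    (A : Set (Set (EuclideanSpace ℝ (Fin n)))) (B : Set (EuclideanSpace ℝ (Fin n)))
    (hA : IsCentralArrangement A) (hss : IsSupersolvable A)
    (hB : IsCanonicalBase A B) :
    regionOrderDim A B = arrRank A := by
  obtain ⟨hfin, -, hyp⟩ := hA
  have hreg : IsRegion A B := by
    cases hB with
    | low _ _ _ h => exact h
    | step _ _ _ _ _ _ _ _ _ h => exact h
  obtain ⟨b, hb, rfl⟩ := hreg
  obtain ⟨ν, hν⟩ := exists_isNormalChoice hyp hb
  obtain ⟨f, hf⟩ := hB.negSetEmbeds hfin (subset_closure (mem_connectedComponentIn hb)) hν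
  refine le_antisymm (Nat.sInf_le ⟨fun R => f R.2.choose, fun R₁ R₂ => ?_⟩)
    (le_csInf ⟨_, fun R => f R.2.choose, fun R₁ R₂ => ?_⟩ ?_)
  · rw [← hf, ← hν.regLE_iff hfin R₁.2.choose_spec.1 R₂.2.choose_spec.1,
      ← R₁.2.choose_spec.2, ← R₂.2.choose_spec.2]
  · rw [← hf, ← hν.regLE_iff hfin R₁.2.choose_spec.1 R₂.2.choose_spec.1,
      ← R₁.2.choose_spec.2, ← R₂.2.choose_spec.2]
  · rintro d ⟨g, hg⟩
    rw [hν.arrRank_eq]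
    exact (finrank_span_image_le_ncard_walls hfin (fun H hH => (hν H hH).2) hν.notMem_span).trans
      (hν.ncard_walls_le hfin g hg)
end
end

section
/- Let 𝒜 be a supersolvable central hyperplane arrangement of rank d in ℝⁿ and let B be a canonical base region. Then 𝒫(𝒜,B) admits a zonotopal embedding in ℝᵈ: there exist normal vectors n_H (H ∈ 𝒜) with S(R) = {H ∈ 𝒜 : ⟨x, n_H⟩ > 0 for all x in the interior of R} for every region R, and linearly independent linear functionals f₁,…,f_d on ℝⁿ, such that for all regions R₁, R₂ one has R₁ ≤ R₂ in 𝒫(𝒜,B) if and only if f_i(Z(R₁)) ≤ f_i(Z(R₂)) for all i = 1,…,d, where Z(R) = Σ_{H ∈ S(R)} n_H. -/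
open scoped RealInnerProductSpace

noncomputable section

variable {n : ℕ}

/-- Positive weights on a finite set that dominate the total weight of all later elements. -/
theorem exists_dominating_weights {α : Type*} (A : Finset α) (t : α → ℝ) :
    ∃ c : α → ℝ, (∀ a, 0 < c a) ∧ ∀ a ∈ A, ∑ a' ∈ A with t a < t a', c a' < c a := by
  classical
  set M : ℝ := A.card + 1 with hM
  have hM1 : 1 ≤ M := by simp [hM]
  refine ⟨fun a => M ^ (A.filter fun a' => t a < t a').card, fun a => by positivity, ?_⟩
  intro a _
  set k := (A.filter fun a' => t a < t a').card with hk
  have hlt : ∀ a' ∈ A.filter fun a' => t a < t a',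
      M ^ (A.filter fun z => t a' < t z).card * M ≤ M ^ k := by
    intro a' ha'
    rw [← pow_succ]
    refine pow_le_pow_right₀ hM1 (Nat.succ_le_of_lt (Finset.card_lt_card ?_))
    rw [Finset.mem_filter] at ha'
    refine (Finset.ssubset_iff_of_subset fun z hz => ?_).2 ⟨a', by simpa using ha', by simp⟩
    rw [Finset.mem_filter] at hz ⊢
    exact ⟨hz.1, ha'.2.trans hz.2⟩
  have hsum := Finset.sum_le_card_nsmul _ _ _ hlt
  rw [← Finset.sum_mul, nsmul_eq_mul, ← hk] at hsum
  have hkA : (k : ℝ) < M := by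
    have : (k : ℝ) ≤ A.card := by exact_mod_cast Finset.card_filter_le _ _
    linarith
  have hpos : 0 < M ^ k := by positivity
  have : (k : ℝ) * M ^ k < M ^ k * M := by
    rw [mul_comm]
    exact mul_lt_mul_of_pos_left hkA hpos
  exact lt_of_mul_lt_mul_right (hsum.trans_lt this) (by linarith)

section Embedding

variable {α E : Type*} [NormedAddCommGroup E] [InnerProductSpace ℝ E]

open Classical in
/-- Positive rescalings of the normals `u a` and `d` functionals, nonnegative and jointly
independent on the normals, which recover the order on sets of hyperplanes having a point on
their positive side. -/
def HasEmbedding (u : α → E) (A : Finset α) (d : ℕ) : Prop :=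
  ∃ (s : α → ℝ) (f : Fin d → (E →ₗ[ℝ] ℝ)), (∀ a ∈ A, 0 < s a) ∧
    (∀ i, ∀ a ∈ A, 0 ≤ f i (u a)) ∧
    (∀ c : Fin d → ℝ, (∀ a ∈ A, ∑ i, c i * f i (u a) = 0) → ∀ i, c i = 0) ∧
    ∀ x y : E, (∀ i, f i (∑ a ∈ A with 0 < ⟪u a, x⟫, s a • u a) ≤
        f i (∑ a ∈ A with 0 < ⟪u a, y⟫, s a • u a)) →
      ∀ a ∈ A, 0 < ⟪u a, x⟫ → 0 < ⟪u a, y⟫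

theorem hasEmbedding_empty (u : α → E) : HasEmbedding u ∅ 0 :=
  ⟨fun _ => 1, Fin.elim0, by simp, by simp, fun _ _ i => i.elim0, by simp⟩

open Classical in
/-- If the strict inequalities between values of a functional hold on finitely many data, they
survive a small perturbation. -/
theorem exists_pos_perturbation {α β ι : Type*} [Finite ι] (A : Finset α) (A' : Finset β)
    (p : ι → Finset α → ℝ) (q : ι → Finset β → ℝ) :
    ∃ ε : ℝ, 0 < ε ∧ ∀ i, ∀ X ∈ A.powerset, ∀ Y ∈ A.powerset, ∀ X' ∈ A'.powerset,
      ∀ Y' ∈ A'.powerset, p i X + ε * q i X' ≤ p i Y + ε * q i Y' → p i X ≤ p i Y := by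
  have h : ∀ᶠ ε : ℝ in nhdsWithin 0 (Set.Ioi 0), ∀ i, ∀ X ∈ A.powerset, ∀ Y ∈ A.powerset,
      ∀ X' ∈ A'.powerset, ∀ Y' ∈ A'.powerset,
      p i X + ε * q i X' ≤ p i Y + ε * q i Y' → p i X ≤ p i Y := by
    simp only [Filter.eventually_all, Filter.eventually_all_finset]
    intro i X _ Y _ X' _ Y' _
    by_cases hXY : p i X ≤ p i Y
    · exact Filter.Eventually.of_forall fun _ _ => hXY
    · have h1 : Continuous fun ε : ℝ => p i X + ε * q i X' := by fun_prop
      have h2 : Continuous fun ε : ℝ => p i Y + ε * q i Y' := by fun_prop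
      have := (h2.tendsto 0).eventually_lt (h1.tendsto 0) (by simpa using hXY)
      filter_upwards [this.filter_mono nhdsWithin_le_nhds] with ε hε hle
      exact absurd hle (not_le.2 hε)
  obtain ⟨ε, hε, hpos⟩ := (h.and self_mem_nhdsWithin).exists
  exact ⟨ε, hpos, hε⟩

/-- Extending an embedding by one dimension along a modular coatom. -/
theorem HasEmbedding.succ {u : α → E} {A₀ A₁ A : Finset α} {d : ℕ} {b w : E}
    (hA : ∀ a, a ∈ A ↔ a ∈ A₀ ∨ a ∈ A₁) (hdisj : Disjoint A₀ A₁) (hne : A₁.Nonempty)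
    (hb : ∀ a ∈ A, ⟪u a, b⟫ < 0)
    (hw₀ : ∀ a ∈ A₀, ⟪w, u a⟫ = 0) (hw₁ : ∀ a ∈ A₁, 0 < ⟪w, u a⟫)
    (hmod : ∀ a' ∈ A₁, ∀ a'' ∈ A₁, a' ≠ a'' → ∃ a ∈ A₀, ∃ p q : ℝ,
      u a = p • u a' + q • u a'')
    (h : HasEmbedding u A₀ d) : HasEmbedding u A (d + 1) := by
  classical
  obtain ⟨s₀, f, hs, hf, hind, hord⟩ := h
  obtain ⟨c, hc, hcsum⟩ := exists_dominating_weights A₁ fun a => -⟪u a, b⟫ / ⟪w, u a⟫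
  have hAeq : A = A₀ ∪ A₁ := by ext a; simp [hA]
  obtain ⟨C, hC⟩ : ∃ C : ℝ, ∀ i, ∀ a ∈ A₁, 0 ≤ f i (u a) + C * ⟪w, u a⟫ := by
    have : ∀ᶠ C : ℝ in Filter.atTop, ∀ i, ∀ a ∈ A₁, 0 ≤ f i (u a) + C * ⟪w, u a⟫ := by
      simp only [Filter.eventually_all, Filter.eventually_all_finset]
      intro i a ha
      filter_upwards [Filter.eventually_ge_atTop (-f i (u a) / ⟪w, u a⟫)] with C hC
      have := (div_le_iff₀ (hw₁ a ha)).1 hC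
      linarith
    exact this.exists
  let g : E →ₗ[ℝ] ℝ := innerₛₗ ℝ w
  have hg : ∀ z, g z = ⟪w, z⟫ := fun z => rfl
  let f' : Fin d → (E →ₗ[ℝ] ℝ) := fun i => f i + C • g
  have hf'₀ : ∀ i, ∀ a ∈ A₀, f' i (u a) = f i (u a) := by
    intro i a ha
    simp [f', hg, hw₀ a ha]
  have hf'₁ : ∀ i, ∀ a ∈ A₁, 0 ≤ f' i (u a) := by
    intro i a ha
    simpa [f', hg] using hC i a ha
  obtain ⟨ε, hε, hpert⟩ := exists_pos_perturbation A₀ A₁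
    (fun i X => f i (∑ a ∈ X, s₀ a • u a))
    (fun i X => f' i (∑ a ∈ X, (c a / ⟪w, u a⟫) • u a))
  let s : α → ℝ := fun a => if a ∈ A₁ then ε * (c a / ⟪w, u a⟫) else s₀ a
  have hs₁ : ∀ a ∈ A₁, s a = ε * (c a / ⟪w, u a⟫) := fun a ha => by simp [s, ha]
  have hs₀ : ∀ a ∈ A₀, s a = s₀ a := fun a ha => by
    simp [s, Finset.disjoint_left.1 hdisj ha]
  have hsplit : ∀ x, (∑ a ∈ A with 0 < ⟪u a, x⟫, s a • u a) =
      (∑ a ∈ A₀ with 0 < ⟪u a, x⟫, s₀ a • u a) +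
        ε • ∑ a ∈ A₁ with 0 < ⟪u a, x⟫, (c a / ⟪w, u a⟫) • u a := by
    intro x
    rw [hAeq, Finset.filter_union, Finset.sum_union (Finset.disjoint_filter_filter hdisj),
      Finset.smul_sum]
    congr 1
    · exact Finset.sum_congr rfl fun a ha => by rw [hs₀ a (Finset.mem_filter.1 ha).1]
    · exact Finset.sum_congr rfl fun a ha => by
        rw [hs₁ a (Finset.mem_filter.1 ha).1, mul_smul]
  have hg₀ : ∀ X ⊆ A₀, g (∑ a ∈ X, s₀ a • u a) = 0 := by
    intro X hX
    rw [map_sum]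
    exact Finset.sum_eq_zero fun a ha => by
      rw [hg, real_inner_smul_right, hw₀ a (hX ha), mul_zero]
  have hg₁ : ∀ X ⊆ A₁, g (∑ a ∈ X, (c a / ⟪w, u a⟫) • u a) = ∑ a ∈ X, c a := by
    intro X hX
    rw [map_sum]
    refine Finset.sum_congr rfl fun a ha => ?_
    rw [map_smul, hg, smul_eq_mul, div_mul_cancel₀ _ (hw₁ a (hX ha)).ne']
  refine ⟨s, Fin.cons g f', ?_, ?_, ?_, ?_⟩
  · intro a ha
    rcases (hA a).1 ha with ha | ha
    · rw [hs₀ a ha]; exact hs a ha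
    · rw [hs₁ a ha]; exact mul_pos hε (div_pos (hc a) (hw₁ a ha))
  · intro i a ha
    rcases (hA a).1 ha with ha | ha <;> refine Fin.cases ?_ (fun i => ?_) i
    · simp [hg, hw₀ a ha]
    · simpa [hf'₀ i a ha] using hf i a ha
    · simpa [hg] using (hw₁ a ha).le
    · simpa using hf'₁ i a ha
  · intro r hr
    have hr₀ : ∀ i : Fin d, r i.succ = 0 := by
      refine hind (fun i => r i.succ) fun a ha => ?_
      have := hr a ((hA a).2 (Or.inl ha))
      rw [Fin.sum_univ_succ] at this
      simpa [hg, hw₀ a ha, hf'₀ _ a ha] using this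
    obtain ⟨a, ha⟩ := hne
    have := hr a ((hA a).2 (Or.inr ha))
    rw [Fin.sum_univ_succ] at this
    simp only [hr₀, Fin.cons_zero, hg, zero_mul, Finset.sum_const_zero, add_zero,
      mul_eq_zero, (hw₁ a ha).ne', or_false] at this
    exact Fin.cases this hr₀
  · intro x y hxy
    have h₀ : ∀ a ∈ A₀, 0 < ⟪u a, x⟫ → 0 < ⟪u a, y⟫ := by
      refine hord x y fun i => ?_
      refine hpert i _ (Finset.mem_powerset.2 (Finset.filter_subset _ _)) _
        (Finset.mem_powerset.2 (Finset.filter_subset _ _)) _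
        (Finset.mem_powerset.2 (Finset.filter_subset (fun a => 0 < ⟪u a, x⟫) _)) _
        (Finset.mem_powerset.2 (Finset.filter_subset (fun a => 0 < ⟪u a, y⟫) _)) ?_
      have hi := hxy i.succ
      have key : ∀ z, f' i (∑ a ∈ A₀ with 0 < ⟪u a, z⟫, s₀ a • u a) =
          f i (∑ a ∈ A₀ with 0 < ⟪u a, z⟫, s₀ a • u a) := by
        intro z
        simp only [f', LinearMap.add_apply, LinearMap.smul_apply,
          hg₀ _ (Finset.filter_subset _ _), smul_zero, add_zero]
      rwa [hsplit, hsplit, Fin.cons_succ, map_add, map_add, key, key, map_smul, map_smul]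
        at hi
    intro a ha hax
    rcases (hA a).1 ha with ha | ha
    · exact h₀ a ha hax
    by_contra hay
    have h0 := hxy 0
    rw [hsplit, hsplit, Fin.cons_zero, map_add, map_add, hg₀ _ (Finset.filter_subset _ _),
      hg₀ _ (Finset.filter_subset _ _), map_smul, map_smul, hg₁ _ (Finset.filter_subset _ _),
      hg₁ _ (Finset.filter_subset _ _), zero_add, zero_add, smul_eq_mul, smul_eq_mul,
      mul_le_mul_iff_right₀ hε] at h0
    set X := A₁.filter fun a => 0 < ⟪u a, x⟫ with hX
    set Y := A₁.filter fun a => 0 < ⟪u a, y⟫ with hY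
    have hlater : Y \ X ⊆ A₁.filter fun a' => -⟪u a, b⟫ / ⟪w, u a⟫ <
        -⟪u a', b⟫ / ⟪w, u a'⟫ := by
      intro a' ha'
      simp only [hX, hY, Finset.mem_sdiff, Finset.mem_filter, not_and, not_lt] at ha'
      obtain ⟨⟨ha', hy'⟩, hx'⟩ := ha'
      specialize hx' ha'
      have hne : a ≠ a' := by rintro rfl; exact hay hy'
      refine Finset.mem_filter.2 ⟨ha', ?_⟩
      obtain ⟨a₀, ha₀, p, q, hpq⟩ := hmod a ha a' ha' hne
      have hwa := hw₁ a ha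
      have hwa' := hw₁ a' ha'
      have e1 : p * ⟪w, u a⟫ + q * ⟪w, u a'⟫ = 0 := by
        rw [← hw₀ a₀ ha₀, hpq, inner_add_right, inner_smul_right, inner_smul_right]
      have e2 : ∀ z, ⟪u a₀, z⟫ = p * ⟪u a, z⟫ + q * ⟪u a', z⟫ := fun z => by
        rw [hpq, inner_add_left, real_inner_smul_left, real_inner_smul_left]
      have hb0 := hb a₀ ((hA _).2 (Or.inl ha₀))
      rw [e2] at hb0
      push Not at hay
      have hq : q = -(p * ⟪w, u a⟫ / ⟪w, u a'⟫) := by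
        field_simp
        linarith
      rw [div_lt_div_iff₀ hwa hwa']
      have hp : p < 0 := by
        by_contra hp
        push Not at hp
        have hq0 : q ≤ 0 := by
          rw [hq]
          exact neg_nonpos.2 (by positivity)
        have hp0 : 0 < p := by
          rcases hp.eq_or_lt with hp | hp
          · simp [hq, ← hp] at hb0
          · exact hp
        have hpx : 0 < ⟪u a₀, x⟫ := by
          rw [e2]
          have := mul_pos hp0 hax
          have := mul_nonneg_of_nonpos_of_nonpos hq0 hx'
          linarith
        have hpy := h₀ a₀ ha₀ hpx
        rw [e2] at hpy
        have := mul_nonpos_of_nonneg_of_nonpos hp hay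
        have := mul_nonpos_of_nonpos_of_nonneg hq0 hy'.le
        linarith
      have hid : (p * ⟪u a, b⟫ + q * ⟪u a', b⟫) * ⟪w, u a'⟫ =
          p * (⟪u a, b⟫ * ⟪w, u a'⟫ - ⟪u a', b⟫ * ⟪w, u a⟫) := by
        linear_combination ⟪u a', b⟫ * e1
      have := mul_neg_of_neg_of_pos hb0 hwa'
      rw [hid] at this
      have := pos_of_mul_neg_right this hp.le
      linarith
    have haX : a ∈ X \ Y := by simp [hX, hY, ha, hax, not_lt.1 hay]
    have h1 : ∑ z ∈ X \ Y, c z - ∑ z ∈ Y \ X, c z = ∑ z ∈ X, c z - ∑ z ∈ Y, c z :=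
      Finset.sum_sdiff_sub_sum_sdiff
    have h2 : c a ≤ ∑ z ∈ X \ Y, c z := Finset.single_le_sum (fun z _ => (hc z).le) haX
    have h3 : ∑ z ∈ Y \ X, c z ≤ _ :=
      Finset.sum_le_sum_of_subset_of_nonneg hlater fun z _ _ => (hc z).le
    have h4 := hcsum a ha
    linarith

end Embedding

theorem mul_pos_iff_neg_of_neg_left {a c : ℝ} (h : a < 0) : 0 < a * c ↔ c < 0 := by
  rw [← neg_mul_neg, mul_pos_iff_of_pos_left (neg_pos.2 h), neg_pos]

theorem hyperplane_smul {E : Type*} [NormedAddCommGroup E] [InnerProductSpace ℝ E] {u : E} {k : ℝ}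
    (hk : k ≠ 0) :
    {x | ⟪k • u, x⟫ = 0} = {x | ⟪u, x⟫ = 0} := by
  ext x
  simp [real_inner_smul_left, hk]

section LinearAlgebra

variable {E : Type*} [NormedAddCommGroup E] [InnerProductSpace ℝ E] [FiniteDimensional ℝ E]

theorem mem_span_of_forall_inner_eq_zero {S : Set E} {v : E}
    (h : ∀ x, (∀ s ∈ S, ⟪s, x⟫ = 0) → ⟪v, x⟫ = 0) : v ∈ Submodule.span ℝ S := by
  rw [← Submodule.orthogonal_orthogonal (Submodule.span ℝ S), Submodule.mem_orthogonal']
  exact fun x hx => h x fun s hs =>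
    (Submodule.mem_orthogonal _ _).1 hx s (Submodule.subset_span hs)

theorem exists_eq_smul_of_hyperplane_eq {u v : E}
    (h : {x | ⟪v, x⟫ = 0} = {x | ⟪u, x⟫ = 0}) : ∃ k : ℝ, v = k • u := by
  have : v ∈ Submodule.span ℝ {u} := mem_span_of_forall_inner_eq_zero fun x hx => by
    have : x ∈ {x | ⟪u, x⟫ = 0} := hx u rfl
    rwa [← h] at this
  obtain ⟨k, hk⟩ := Submodule.mem_span_singleton.1 this
  exact ⟨k, hk.symm⟩

end LinearAlgebra

/-- `u` chooses a normal vector for each hyperplane of `A`, negative at the point `b`. -/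
def IsNormalization (A : Set (Set (EuclideanSpace ℝ (Fin n))))
    (u : Set (EuclideanSpace ℝ (Fin n)) → EuclideanSpace ℝ (Fin n))
    (b : EuclideanSpace ℝ (Fin n)) : Prop :=
  ∀ H ∈ A, H = {x | ⟪u H, x⟫ = 0} ∧ ⟪u H, b⟫ < 0

/-- The open cell containing `x` of the arrangement `A` with normals `u`. -/
def cell (A : Set (Set (EuclideanSpace ℝ (Fin n))))
    (u : Set (EuclideanSpace ℝ (Fin n)) → EuclideanSpace ℝ (Fin n))
    (x : EuclideanSpace ℝ (Fin n)) : Set (EuclideanSpace ℝ (Fin n)) :=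
  {y | ∀ H ∈ A, 0 < ⟪u H, x⟫ * ⟪u H, y⟫}

section Regions

variable {A : Set (Set (EuclideanSpace ℝ (Fin n)))}
  {u : Set (EuclideanSpace ℝ (Fin n)) → EuclideanSpace ℝ (Fin n)}
  {b : EuclideanSpace ℝ (Fin n)}

theorem IsNormalization.mono (hu : IsNormalization A u b)
    {A' : Set (Set (EuclideanSpace ℝ (Fin n)))} (h : A' ⊆ A) : IsNormalization A' u b :=
  fun H hH => hu H (h hH)

theorem IsNormalization.eq_of_smul (hu : IsNormalization A u b)
    {H H' : Set (EuclideanSpace ℝ (Fin n))} (hH : H ∈ A) (hH' : H' ∈ A) {k : ℝ}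
    (h : u H = k • u H') : H = H' := by
  have hk : k ≠ 0 := by
    rintro rfl
    have := (hu H hH).2
    simp [h] at this
  rw [(hu H hH).1, (hu H' hH').1, h, hyperplane_smul hk]

theorem exists_isNormalization (hA : ∀ H ∈ A, IsHyperplane H) (hb : b ∈ arrComplement A) :
    ∃ u, IsNormalization A u b := by
  classical
  have : ∀ H, ∃ v : EuclideanSpace ℝ (Fin n), H ∈ A → H = {x | ⟪v, x⟫ = 0} ∧ ⟪v, b⟫ < 0 := by
    intro H
    by_cases hH : H ∈ A
    · obtain ⟨v, -, hv⟩ := hA H hH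
      have hbv : ⟪v, b⟫ ≠ 0 := fun h => hb (Set.mem_biUnion hH (by rw [hv]; exact h))
      rcases hbv.lt_or_gt with h | h
      · exact ⟨v, fun _ => ⟨hv, h⟩⟩
      · refine ⟨-v, fun _ => ⟨?_, by simpa using h⟩⟩
        rw [hv]
        simp
    · exact ⟨0, fun h => absurd h hH⟩
  choose u hu using this
  exact ⟨u, hu⟩

theorem IsNormalization.mem_arrComplement (hu : IsNormalization A u b)
    {x : EuclideanSpace ℝ (Fin n)} : x ∈ arrComplement A ↔ ∀ H ∈ A, ⟪u H, x⟫ ≠ 0 := by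
  simp only [arrComplement, Set.mem_compl_iff, Set.mem_iUnion, not_exists]
  refine forall₂_congr fun H hH => not_congr ?_
  conv_lhs => rw [(hu H hH).1]
  rfl

theorem mem_cell_self (hu : IsNormalization A u b) {x : EuclideanSpace ℝ (Fin n)}
    (hx : x ∈ arrComplement A) : x ∈ cell A u x :=
  fun H hH => mul_self_pos.2 (hu.mem_arrComplement.1 hx H hH)

theorem cell_subset (hu : IsNormalization A u b) (x : EuclideanSpace ℝ (Fin n)) :
    cell A u x ⊆ arrComplement A :=
  fun _ hy => hu.mem_arrComplement.2 fun H hH h => by simpa [h] using hy H hH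

theorem convex_cell (x : EuclideanSpace ℝ (Fin n)) : Convex ℝ (cell A u x) := by
  intro y hy z hz s t hs ht hst H hH
  have h1 := hy H hH
  have h2 := hz H hH
  rw [inner_add_right, real_inner_smul_right, real_inner_smul_right]
  have : 0 < s * (⟪u H, x⟫ * ⟪u H, y⟫) + t * (⟪u H, x⟫ * ⟪u H, z⟫) := by
    rcases hs.eq_or_lt with rfl | hs
    · rw [zero_add] at hst
      simpa [hst] using h2
    · exact add_pos_of_pos_of_nonneg (mul_pos hs h1) (mul_nonneg ht h2.le)
  linarith

theorem isOpen_cell (hA : A.Finite) (x : EuclideanSpace ℝ (Fin n)) : IsOpen (cell A u x) := by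
  have : cell A u x = ⋂ H ∈ A, {y | 0 < ⟪u H, x⟫ * ⟪u H, y⟫} := by
    ext y; simp [cell]
  rw [this]
  exact hA.isOpen_biInter fun H _ => isOpen_lt continuous_const (by fun_prop)

theorem connectedComponentIn_eq_cell (hu : IsNormalization A u b)
    {x : EuclideanSpace ℝ (Fin n)} (hx : x ∈ arrComplement A) :
    connectedComponentIn (arrComplement A) x = cell A u x := by
  refine subset_antisymm (fun y hy H hH => ?_)
    ((convex_cell x).isPreconnected.subset_connectedComponentIn (mem_cell_self hu hx)
      (cell_subset hu x))
  have hx0 := hu.mem_arrComplement.1 hx H hH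
  by_contra hneg
  have hpre := isPreconnected_connectedComponentIn (F := arrComplement A) (x := x)
  obtain ⟨z, hz, hz0⟩ := hpre.intermediate_value hy (mem_connectedComponentIn hx)
    (f := fun z => ⟪u H, x⟫ * ⟪u H, z⟫) (by fun_prop)
    ⟨not_lt.1 hneg, (mul_self_pos.2 hx0).le⟩
  have hz1 := hu.mem_arrComplement.1 (connectedComponentIn_subset _ _ hz) H hH
  exact (mul_ne_zero hx0 hz1) hz0

theorem isRegion_iff (hu : IsNormalization A u b) {R : Set (EuclideanSpace ℝ (Fin n))} :
    IsRegion A R ↔ ∃ x ∈ arrComplement A, R = closure (cell A u x) := by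
  refine exists_congr fun x => and_congr_right fun hx => ?_
  rw [connectedComponentIn_eq_cell hu hx]

theorem interior_closure_cell (hu : IsNormalization A u b) (hA : A.Finite)
    {x : EuclideanSpace ℝ (Fin n)} (hx : x ∈ arrComplement A) :
    interior (closure (cell A u x)) = cell A u x := by
  have h := (isOpen_cell (u := u) hA x).interior_eq
  rw [(convex_cell x).interior_closure_eq_interior_of_nonempty_interior, h]
  rw [h]
  exact ⟨x, mem_cell_self hu hx⟩

theorem cell_eq_of_mem {x y : EuclideanSpace ℝ (Fin n)}
    (h : y ∈ cell A u x) : cell A u y = cell A u x := by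
  ext z
  refine forall₂_congr fun H hH => ?_
  have := h H hH
  rcases mul_pos_iff.1 this with ⟨h1, h2⟩ | ⟨h1, h2⟩
  · rw [mul_pos_iff_of_pos_left h1, mul_pos_iff_of_pos_left h2]
  · rw [mul_pos_iff_neg_of_neg_left h1, mul_pos_iff_neg_of_neg_left h2]

/-- A region is the closure of the cell of any of its interior points. -/
theorem IsRegion.eq_closure_cell (hu : IsNormalization A u b) (hA : A.Finite)
    {R : Set (EuclideanSpace ℝ (Fin n))} (hR : IsRegion A R) {y : EuclideanSpace ℝ (Fin n)}
    (hy : y ∈ interior R) : R = closure (cell A u y) := by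
  obtain ⟨x, hx, rfl⟩ := (isRegion_iff hu).1 hR
  rw [interior_closure_cell hu hA hx] at hy
  rw [cell_eq_of_mem hy]

theorem sepSet_closure_cell (hu : IsNormalization A u b) (hA : A.Finite)
    {y : EuclideanSpace ℝ (Fin n)} (hy : y ∈ arrComplement A) :
    sepSet A (closure (cell A u b)) (closure (cell A u y)) = {H | H ∈ A ∧ 0 < ⟪u H, y⟫} := by
  have hb : b ∈ arrComplement A := hu.mem_arrComplement.2 fun H hH => (hu H hH).2.ne
  ext H
  refine and_congr_right fun hH => ?_
  rw [Separates, interior_closure_cell hu hA hy, interior_closure_cell hu hA hb]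
  have hub := (hu H hH).2
  constructor
  · rintro ⟨v, -, hv, h1, h2⟩
    obtain ⟨k, rfl⟩ := exists_eq_smul_of_hyperplane_eq (hv.symm.trans (hu H hH).1)
    have h1 := h1 y (mem_cell_self hu hy)
    have h2 := h2 b (mem_cell_self hu hb)
    rw [real_inner_smul_left] at h1 h2
    exact pos_of_mul_pos_right h1 (pos_of_mul_neg_left h2 hub.le).le
  · intro h
    refine ⟨u H, ?_, (hu H hH).1, fun x hx => ?_, fun x hx => ?_⟩
    · intro h0
      simp [h0] at h
    · exact (mul_pos_iff_of_pos_left h).1 (hx H hH)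
    · exact (mul_pos_iff_neg_of_neg_left hub).1 (hx H hH)

theorem arrSpan_eq_span (hu : IsNormalization A u b) :
    arrSpan A = Submodule.span ℝ (u '' A) := by
  have : (⋂₀ A : Set (EuclideanSpace ℝ (Fin n))) =
      ((Submodule.span ℝ (u '' A))ᗮ : Submodule ℝ (EuclideanSpace ℝ (Fin n))) := by
    ext x
    simp only [Set.mem_sInter, SetLike.mem_coe, Submodule.mem_orthogonal]
    constructor
    · intro h v hv
      induction hv using Submodule.span_induction with
      | mem v hv =>
        obtain ⟨H, hH, rfl⟩ := hv
        have := h H hH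
        rwa [(hu H hH).1] at this
      | zero => simp
      | add v w _ _ hv hw => rw [inner_add_left, hv, hw, add_zero]
      | smul k v _ hv => rw [real_inner_smul_left, hv, mul_zero]
    · intro h H hH
      rw [(hu H hH).1]
      exact h _ (Submodule.subset_span ⟨H, hH, rfl⟩)
  rw [arrSpan, this, Submodule.span_eq, Submodule.orthogonal_orthogonal]

end Regions

section Canonical

variable {A : Set (Set (EuclideanSpace ℝ (Fin n)))}
  {u : Set (EuclideanSpace ℝ (Fin n)) → EuclideanSpace ℝ (Fin n)}
  {b : EuclideanSpace ℝ (Fin n)}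

theorem IsNormalization.linearIndependent_pair (hu : IsNormalization A u b)
    {H H' : Set (EuclideanSpace ℝ (Fin n))} (hH : H ∈ A) (hH' : H' ∈ A) (hne : H ≠ H') :
    LinearIndependent ℝ ![u H, u H'] := by
  have h0 : u H ≠ 0 := fun h => by simpa [h] using (hu H hH).2
  rw [LinearIndependent.pair_iff' h0]
  exact fun k hk => hne (hu.eq_of_smul hH' hH hk.symm).symm

/-- Two distinct hyperplanes force the rank to be at least two; in rank two their normals span. -/
theorem IsNormalization.two_le_arrRank (hu : IsNormalization A u b)
    {H H' : Set (EuclideanSpace ℝ (Fin n))} (hH : H ∈ A) (hH' : H' ∈ A) (hne : H ≠ H') :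
    2 ≤ arrRank A ∧ (arrRank A ≤ 2 → ∀ K ∈ A, ∃ p q : ℝ, u K = p • u H + q • u H') := by
  have hle : Submodule.span ℝ {u H, u H'} ≤ arrSpan A := by
    rw [arrSpan_eq_span hu]
    refine Submodule.span_mono ?_
    rintro _ (rfl | rfl)
    exacts [⟨H, hH, rfl⟩, ⟨H', hH', rfl⟩]
  have hfin : Module.finrank ℝ (Submodule.span ℝ {u H, u H'}) = 2 := by
    rw [← Matrix.range_cons_cons_empty (u H) (u H') ![],
      finrank_span_eq_card (hu.linearIndependent_pair hH hH' hne), Fintype.card_fin]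
  refine ⟨hfin ▸ Submodule.finrank_mono hle, fun h2 K hK => ?_⟩
  have heq := Submodule.eq_of_le_of_finrank_le hle (h2.trans hfin.ge)
  have : u K ∈ Submodule.span ℝ {u H, u H'} := by
    rw [heq, arrSpan_eq_span hu]
    exact Submodule.subset_span ⟨K, hK, rfl⟩
  obtain ⟨p, q, h⟩ := Submodule.mem_span_pair.1 this
  exact ⟨p, q, h.symm⟩

theorem hasEmbedding_singleton (hu : IsNormalization A u b)
    {H : Set (EuclideanSpace ℝ (Fin n))} (hH : H ∈ A) : HasEmbedding u {H} 1 := by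
  have h0 : u H ≠ 0 := fun h => by simpa [h] using (hu H hH).2
  refine (hasEmbedding_empty u).succ (A₁ := {H}) (b := b) (w := u H) (by simp) (by simp)
    (by simp) ?_ (by simp) ?_ ?_
  · simpa using (hu H hH).2
  · simpa only [Finset.mem_singleton, forall_eq] using real_inner_self_pos.2 h0
  · intro a ha c hc hne
    rw [Finset.mem_singleton] at ha hc
    exact absurd (ha.trans hc.symm) hne

theorem hasEmbedding_of_arrRank_le_two (hu : IsNormalization A u b) (hA : A.Finite)
    (h2 : arrRank A ≤ 2) : HasEmbedding u hA.toFinset (arrRank A) := by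
  classical
  rcases A.subsingleton_or_nontrivial with hsub | ⟨H₁, h₁, H₂, h₂, hne⟩
  · rcases hsub.eq_empty_or_singleton with rfl | ⟨H, rfl⟩
    · have : arrRank (∅ : Set (Set (EuclideanSpace ℝ (Fin n)))) = 0 := by
        rw [arrRank, arrSpan_eq_span hu]
        simp
      rw [this]
      simpa using hasEmbedding_empty u
    · have h0 : u H ≠ 0 := fun h => by simpa [h] using (hu H rfl).2
      have : arrRank {H} = 1 := by
        rw [arrRank, arrSpan_eq_span hu, Set.image_singleton, finrank_span_singleton h0]
      rw [this]
      simpa using hasEmbedding_singleton hu (H := H) rfl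
  obtain ⟨h2', hspan⟩ := hu.two_le_arrRank h₁ h₂ hne
  specialize hspan h2
  rw [le_antisymm h2 h2']
  obtain ⟨m, hm⟩ : ∃ m : Set (EuclideanSpace ℝ (Fin n)) → EuclideanSpace ℝ (Fin n),
      ∀ H, m H = (-⟪u H, b⟫)⁻¹ • u H := ⟨_, fun _ => rfl⟩
  -- `m H` is the normal with `⟪m H, b⟫ = -1`; all these lie on a line with direction `e`
  have hmb : ∀ H ∈ A, ⟪m H, b⟫ = -1 := by
    intro H hH
    have := (hu H hH).2.ne
    simp only [hm, real_inner_smul_left]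
    field_simp
  have hum : ∀ H ∈ A, u H = (-⟪u H, b⟫) • m H := by
    intro H hH
    rw [hm, smul_smul, mul_inv_cancel₀ (neg_pos.2 (hu H hH).2).ne', one_smul]
  have hminj : ∀ H ∈ A, ∀ H' ∈ A, m H = m H' → H = H' := by
    intro H hH H' hH' h
    refine hu.eq_of_smul hH hH' (k := (-⟪u H, b⟫) * (-⟪u H', b⟫)⁻¹) ?_
    exact (hum H hH).trans (by rw [h, hm, smul_smul])
  set e := m H₁ - m H₂ with he
  have he0 : e ≠ 0 := fun h => hne (hminj H₁ h₁ H₂ h₂ (sub_eq_zero.1 h))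
  have hline : ∀ H ∈ A, ∃ p : ℝ, m H = m H₂ + p • e := by
    intro H hH
    obtain ⟨p, q, hpq⟩ := hspan H hH
    have hc := (hu H hH).2.ne
    set p' := (-⟪u H, b⟫)⁻¹ * p * (-⟪u H₁, b⟫) with hp'
    set q' := (-⟪u H, b⟫)⁻¹ * q * (-⟪u H₂, b⟫) with hq'
    have h : m H = p' • m H₁ + q' • m H₂ := by
      rw [hp', hq', mul_smul _ _ (m H₁), mul_smul _ _ (m H₂), ← hum H₁ h₁, ← hum H₂ h₂,
        mul_smul, mul_smul, ← smul_add, ← hpq, hm]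
    have hsum : q' = 1 - p' := by
      have := hmb H hH
      rw [h, inner_add_left, real_inner_smul_left, real_inner_smul_left, hmb H₁ h₁,
        hmb H₂ h₂] at this
      linarith
    refine ⟨p', ?_⟩
    rw [h, hsum, he]
    module
  choose! p hp using hline
  obtain ⟨H₀, hH₀, hmin⟩ := Set.exists_min_image A p hA ⟨H₁, h₁⟩
  have hpinj : ∀ H ∈ A, H ≠ H₀ → p H₀ < p H := by
    intro H hH hne
    refine (hmin H hH).lt_of_ne fun h => hne (hminj H hH H₀ hH₀ ?_)
    rw [hp H hH, hp H₀ hH₀, h]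
  set w := e + ⟪e, m H₀⟫ • b with hw
  have hwm : ∀ H ∈ A, ⟪w, m H⟫ = (p H - p H₀) * ⟪e, e⟫ := by
    intro H hH
    rw [hw, inner_add_left, real_inner_smul_left, real_inner_comm (m H) b, hmb H hH, hp H hH,
      hp H₀ hH₀]
    simp only [inner_add_right, real_inner_smul_right]
    ring
  have hee : 0 < ⟪e, e⟫ := real_inner_self_pos.2 he0
  refine (hasEmbedding_singleton hu hH₀).succ (A₁ := hA.toFinset.erase H₀) (b := b) (w := w)
    ?_ (by simp) ?_ ?_ ?_ ?_ ?_
  · intro a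
    by_cases h : a = H₀ <;> simp [h, hH₀]
  · by_cases h : H₁ = H₀
    · exact ⟨H₂, by simp [h₂, ← h, hne.symm]⟩
    · exact ⟨H₁, by simp [h₁, h]⟩
  · intro H hH
    exact (hu H (by simpa using hH)).2
  · intro H hH
    rw [Finset.mem_singleton.1 hH, hum H₀ hH₀, real_inner_smul_right, hwm H₀ hH₀]
    simp
  · intro H hH
    simp only [Finset.mem_erase, Set.Finite.mem_toFinset] at hH
    rw [hum H hH.2, real_inner_smul_right, hwm H hH.2]
    exact mul_pos (neg_pos.2 (hu H hH.2).2) (mul_pos (sub_pos.2 (hpinj H hH.2 hH.1)) hee)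
  · intro H hH H' hH' hne'
    simp only [Finset.mem_erase, Set.Finite.mem_toFinset] at hH hH'
    exact ⟨H₀, by simp, (hu.two_le_arrRank hH.2 hH'.2 hne').2 h2 H₀ hH₀⟩

/-- A modular coatom of an arrangement with canonical base region admits a vector orthogonal to
its normals and on the positive side of all other normals. -/
theorem exists_modular_direction {A₀ A₁ : Set (Set (EuclideanSpace ℝ (Fin n)))}
    {B₀ : Set (EuclideanSpace ℝ (Fin n))}
    (hu : IsNormalization (A₀ ∪ A₁) u b) (hfin : (A₀ ∪ A₁).Finite) (hdisj : Disjoint A₀ A₁)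
    (hrank : arrRank A₀ < arrRank (A₀ ∪ A₁))
    (hmod : ∀ H' ∈ A₁, ∀ H'' ∈ A₁, H' ≠ H'' → ∃ H ∈ A₀, ∃ p q : ℝ,
      u H = p • u H' + q • u H'')
    (hB₀ : B₀ = closure (cell A₀ u b))
    (hlin : ∀ R R', IsRegion (A₀ ∪ A₁) R → IsRegion (A₀ ∪ A₁) R' → R ⊆ B₀ → R' ⊆ B₀ →
      regLE (A₀ ∪ A₁) (closure (cell (A₀ ∪ A₁) u b)) R R' ∨
        regLE (A₀ ∪ A₁) (closure (cell (A₀ ∪ A₁) u b)) R' R) :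
    A₁.Nonempty ∧ ∃ w : EuclideanSpace ℝ (Fin n), (∀ H ∈ A₀, ⟪w, u H⟫ = 0) ∧
      ∀ H ∈ A₁, 0 < ⟪w, u H⟫ := by
  have hu₀ := hu.mono (A' := A₀) Set.subset_union_left
  set V := Submodule.span ℝ (u '' A₀) with hV
  obtain ⟨K, hK, hKV⟩ : ∃ K ∈ A₁, u K ∉ V := by
    by_contra! h
    refine hrank.not_ge (Submodule.finrank_mono ?_)
    rw [arrSpan_eq_span hu, arrSpan_eq_span hu₀, Submodule.span_le]
    rintro _ ⟨H, hH | hH, rfl⟩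
    · exact Submodule.subset_span ⟨H, hH, rfl⟩
    · exact h H hH
  refine ⟨⟨K, hK⟩, ?_⟩
  obtain ⟨w, hw₀, hwK⟩ : ∃ w, (∀ H ∈ A₀, ⟪w, u H⟫ = 0) ∧ ⟪w, u K⟫ ≠ 0 := by
    by_contra! h
    refine hKV (mem_span_of_forall_inner_eq_zero fun x hx => ?_)
    rw [real_inner_comm]
    refine h x fun H hH => ?_
    rw [real_inner_comm]
    exact hx _ ⟨H, hH, rfl⟩
  have hw₁ : ∀ H ∈ A₁, ⟪w, u H⟫ ≠ 0 := by
    intro H hH h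
    have hne : H ≠ K := by rintro rfl; exact hwK h
    obtain ⟨H₀, hH₀, p, q, hpq⟩ := hmod H hH K hK hne
    have h0 := hw₀ H₀ hH₀
    rw [hpq, inner_add_right, real_inner_smul_right, real_inner_smul_right, h, mul_zero,
      zero_add, mul_eq_zero, or_iff_left hwK] at h0
    rw [h0, zero_smul, add_zero] at hpq
    have := hu.eq_of_smul (Or.inl hH₀) (Or.inr hH) hpq
    exact Set.disjoint_left.1 hdisj hH₀ (this ▸ hH)
  obtain ⟨T, hT0, hT⟩ : ∃ T : ℝ, 0 < T ∧ ∀ H ∈ A₁, -⟪u H, b⟫ < T * |⟪w, u H⟫| := by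
    have : ∀ᶠ T : ℝ in Filter.atTop, ∀ H ∈ A₁, -⟪u H, b⟫ < T * |⟪w, u H⟫| := by
      rw [Filter.eventually_all_finite (hfin.subset Set.subset_union_right)]
      intro H hH
      filter_upwards [Filter.eventually_gt_atTop (-⟪u H, b⟫ / |⟪w, u H⟫|)] with T hT
      exact (div_lt_iff₀ (abs_pos.2 (hw₁ H hH))).1 hT
    obtain ⟨T, h1, h2⟩ := (this.and (Filter.eventually_gt_atTop 0)).exists
    exact ⟨T, h2, h1⟩
  -- the points `b ± T w` lie in extreme regions inside `B₀`
  have key : ∀ k : ℝ, |k| = T →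
      (∀ H ∈ A₀, ⟪u H, b + k • w⟫ = ⟪u H, b⟫) ∧
      (∀ H ∈ A₁, 0 < ⟪u H, b + k • w⟫ ↔ 0 < k * ⟪w, u H⟫) ∧
      b + k • w ∈ arrComplement (A₀ ∪ A₁) := by
    intro k hk
    have e : ∀ H, ⟪u H, b + k • w⟫ = ⟪u H, b⟫ + k * ⟪w, u H⟫ := fun H => by
      rw [inner_add_right, real_inner_smul_right, real_inner_comm w]
    have h0 : ∀ H ∈ A₀, ⟪u H, b + k • w⟫ = ⟪u H, b⟫ := fun H hH => by
      rw [e, hw₀ H hH, mul_zero, add_zero]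
    have h1 : ∀ H ∈ A₁, ⟪u H, b⟫ < 0 ∧ -⟪u H, b⟫ < |k * ⟪w, u H⟫| := fun H hH =>
      ⟨(hu H (Or.inr hH)).2, by rw [abs_mul, hk]; exact hT H hH⟩
    refine ⟨h0, fun H hH => ?_, hu.mem_arrComplement.2 ?_⟩
    · obtain ⟨h2, h3⟩ := h1 H hH
      rw [e]
      constructor
      · intro h
        linarith
      · intro h
        rw [abs_of_pos h] at h3
        linarith
    · rintro H (hH | hH)
      · rw [h0 H hH]
        exact (hu₀ H hH).2.ne
      · obtain ⟨h2, h3⟩ := h1 H hH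
        rw [e]
        intro h
        rcases lt_abs.1 h3 with h3 | h3 <;> linarith
  have hreg : ∀ k : ℝ, |k| = T → IsRegion (A₀ ∪ A₁) (closure (cell (A₀ ∪ A₁) u (b + k • w))) ∧
      closure (cell (A₀ ∪ A₁) u (b + k • w)) ⊆ B₀ := by
    intro k hk
    obtain ⟨h0, -, hc⟩ := key k hk
    refine ⟨(isRegion_iff hu).2 ⟨_, hc, rfl⟩, hB₀ ▸ closure_mono fun z hz H hH => ?_⟩
    have := hz H (Or.inl hH)
    rwa [h0 H hH] at this
  have hmono : ∀ k : ℝ, |k| = T → regLE (A₀ ∪ A₁) (closure (cell (A₀ ∪ A₁) u b))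
      (closure (cell (A₀ ∪ A₁) u (b + (-k) • w))) (closure (cell (A₀ ∪ A₁) u (b + k • w))) →
      ∀ H ∈ A₁, 0 < k * ⟪w, u H⟫ := by
    intro k hk hle H hH
    have hk' : |(-k)| = T := by rwa [abs_neg]
    obtain ⟨-, h1, hc⟩ := key k hk
    obtain ⟨-, h1', hc'⟩ := key (-k) hk'
    rw [regLE, sepSet_closure_cell hu hfin hc, sepSet_closure_cell hu hfin hc'] at hle
    have hk0 : k ≠ 0 := by
      rintro rfl
      simp [← hk] at hT0
    rcases (mul_ne_zero hk0 (hw₁ H hH)).lt_or_gt with h | h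
    · have := (hle ⟨Or.inr hH, (h1' H hH).2 (by linarith)⟩).2
      exact (h1 H hH).1 this
    · exact h
  have hTT : |T| = T := abs_of_pos hT0
  have hTT' : |(-T)| = T := by rw [abs_neg, hTT]
  obtain ⟨k, hk⟩ : ∃ k : ℝ, ∀ H ∈ A₁, 0 < k * ⟪w, u H⟫ := by
    rcases hlin _ _ (hreg (-T) hTT').1 (hreg T hTT).1 (hreg (-T) hTT').2 (hreg T hTT).2 with
      h | h
    · exact ⟨T, hmono T hTT h⟩
    · exact ⟨-T, hmono (-T) hTT' (by rwa [neg_neg])⟩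
  refine ⟨k • w, fun H hH => ?_, fun H hH => ?_⟩
  · rw [real_inner_smul_left, hw₀ H hH, mul_zero]
  · rw [real_inner_smul_left]
    exact hk H hH

theorem IsCanonicalBase.isRegion {B : Set (EuclideanSpace ℝ (Fin n))}
    (h : IsCanonicalBase A B) : IsRegion A B := by
  cases h <;> assumption

theorem IsCanonicalBase.hasEmbedding {B : Set (EuclideanSpace ℝ (Fin n))}
    (h : IsCanonicalBase A B) (hA : A.Finite) (hu : IsNormalization A u b)
    (hb : b ∈ interior B) : HasEmbedding u hA.toFinset (arrRank A) := by
  induction h with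
  | low A B h2 hB => exact hasEmbedding_of_arrRank_le_two hu hA h2
  | step A A₀ A₁ B B₀ hAeq hdisj hrank hmod hB hB₀ hBB₀ _ hlin ih =>
    subst hAeq
    have hu₀ := hu.mono (A' := A₀) Set.subset_union_left
    have hA₀ := hA.subset (Set.subset_union_left (s := A₀) (t := A₁))
    have hA₁ := hA.subset (Set.subset_union_right (s := A₀) (t := A₁))
    have hb₀ := interior_mono hBB₀ hb
    have hmod' : ∀ H' ∈ A₁, ∀ H'' ∈ A₁, H' ≠ H'' → ∃ H ∈ A₀, ∃ p q : ℝ,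
        u H = p • u H' + q • u H'' := by
      intro H' h' H'' h'' hne
      obtain ⟨H, ⟨hH, hsub⟩, -⟩ := hmod H' h' H'' h'' hne
      have : u H ∈ Submodule.span ℝ {u H', u H''} := by
        refine mem_span_of_forall_inner_eq_zero fun x hx => ?_
        have hxH : x ∈ H := hsub ⟨?_, ?_⟩
        · rwa [(hu₀ H hH).1] at hxH
        · rw [(hu H' (Or.inr h')).1]
          exact hx _ (by simp)
        · rw [(hu H'' (Or.inr h'')).1]
          exact hx _ (by simp)
      obtain ⟨p, q, h⟩ := Submodule.mem_span_pair.1 this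
      exact ⟨H, hH, p, q, h.symm⟩
    obtain ⟨hne, w, hw₀, hw₁⟩ := exists_modular_direction hu hA hdisj (by omega) hmod'
      (hB₀.eq_closure_cell hu₀ hA₀ hb₀) (hB.eq_closure_cell hu hA hb ▸ hlin)
    rw [← hrank]
    refine (ih hA₀ hu₀ hb₀).succ (A₁ := hA₁.toFinset) (b := b) (w := w) (by simp)
      (by simpa using hdisj) (by simpa using hne) ?_ (by simpa using hw₀) (by simpa using hw₁)
      (by simpa using hmod')
    intro H hH
    exact (hu H (by simpa using hH)).2

end Canonical

/-- **Theorem (Reading, Theorem 23).** Let `A` be a supersolvable central hyperplane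
arrangement of rank `d` and let `B` be a canonical base region.  Then 𝒫(𝒜,B) admits a
zonotopal embedding into ℝᵈ: there are normal vectors `nv H` with
`S(R) = {H ∈ A : ⟪nv H, x⟫ > 0 for all x ∈ interior R}` for every region `R`, and linearly
independent linear functionals `f₁, …, f_d`, such that `R₁ ≤ R₂` in 𝒫(𝒜,B) if and only if
`f_i(Z(R₁)) ≤ f_i(Z(R₂))` for all `i`, where `Z(R) = Σ_{H ∈ S(R)} nv H`. -/
theorem supersolvable_zonotopal_embedding {n : ℕ}
    (A : Set (Set (EuclideanSpace ℝ (Fin n)))) (B : Set (EuclideanSpace ℝ (Fin n)))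
    (hA : IsCentralArrangement A) (hss : IsSupersolvable A)
    (hB : IsCanonicalBase A B) :
    ∃ (nv : Set (EuclideanSpace ℝ (Fin n)) → EuclideanSpace ℝ (Fin n))
      (f : Fin (arrRank A) → (EuclideanSpace ℝ (Fin n) →ₗ[ℝ] ℝ)),
      LinearIndependent ℝ f ∧
      (∀ H ∈ A, H = {x | ⟪nv H, x⟫ = 0}) ∧
      (∀ R, IsRegion A R →
        sepSet A B R = {H | H ∈ A ∧ ∀ x ∈ interior R, 0 < ⟪nv H, x⟫}) ∧
      (∀ R₁ R₂, IsRegion A R₁ → IsRegion A R₂ →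
        (regLE A B R₁ R₂ ↔
          ∀ i, f i (∑ᶠ H ∈ sepSet A B R₁, nv H) ≤ f i (∑ᶠ H ∈ sepSet A B R₂, nv H))) := by

  classical
  obtain ⟨hfin, -, hhyp⟩ := hA
  obtain ⟨b, hb, hBb⟩ := hB.isRegion
  obtain ⟨u, hu⟩ := exists_isNormalization hhyp hb
  rw [connectedComponentIn_eq_cell hu hb] at hBb
  have hbB : b ∈ interior B := by
    rw [hBb, interior_closure_cell hu hfin hb]
    exact mem_cell_self hu hb
  obtain ⟨s, f, hs, hf, hind, hord⟩ := hB.hasEmbedding hfin hu hbB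
  simp only [Set.Finite.mem_toFinset] at hs hf hind hord
  have hsep : ∀ y ∈ arrComplement A,
      sepSet A B (closure (cell A u y)) = {H | H ∈ A ∧ 0 < ⟪u H, y⟫} := fun y hy => by
    rw [hBb, sepSet_closure_cell hu hfin hy]
  refine ⟨fun H => s H • u H, f, ?_, fun H hH => ?_, fun R hR => ?_, fun R₁ R₂ h₁ h₂ => ?_⟩
  · refine Fintype.linearIndependent_iff.2 fun c hc => hind c fun H _ => ?_
    simpa using LinearMap.congr_fun hc (u H)
  · rw [hyperplane_smul (hs H hH).ne']
    exact (hu H hH).1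
  · obtain ⟨y, hy, rfl⟩ := (isRegion_iff hu).1 hR
    rw [hsep y hy, interior_closure_cell hu hfin hy]
    ext H
    refine and_congr_right fun hH => ?_
    simp only [real_inner_smul_left, mul_pos_iff_of_pos_left (hs H hH)]
    exact ⟨fun h x hx => (mul_pos_iff_of_pos_left h).1 (hx H hH),
      fun h => h y (mem_cell_self hu hy)⟩
  · obtain ⟨x, hx, rfl⟩ := (isRegion_iff hu).1 h₁
    obtain ⟨y, hy, rfl⟩ := (isRegion_iff hu).1 h₂
    have hsum : ∀ z, ∑ᶠ H ∈ {H | H ∈ A ∧ 0 < ⟪u H, z⟫}, s H • u H =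
        ∑ H ∈ hfin.toFinset with 0 < ⟪u H, z⟫, s H • u H := fun z => by
      rw [← finsum_mem_coe_finset]
      simp
    rw [regLE, hsep x hx, hsep y hy, hsum, hsum]
    constructor
    · intro hle i
      rw [map_sum, map_sum]
      refine Finset.sum_le_sum_of_subset_of_nonneg (fun H hH => ?_) fun H hH _ => ?_
      · simp only [Finset.mem_filter, Set.Finite.mem_toFinset] at hH ⊢
        exact hle hH
      · simp only [Finset.mem_filter, Set.Finite.mem_toFinset] at hH
        rw [map_smul, smul_eq_mul]
        exact mul_nonneg (hs H hH.1).le (hf i H hH.1)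
    · rintro hle H ⟨hH, hHx⟩
      exact ⟨hH, hord x y hle H hH hHx⟩
end
end
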